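/- There exists a Henselian valued field (K, A) such that A is definable in K by a parameter-free formula of the language of rings, but A is not definable by any ∃∀∃-formula nor by any ∀∃∀-formula of the language of rings, even with parameters removed (parameter-free). -/

import Mathlib

open FirstOrder Language

/-- `IsQN true k φ` says that `φ` is a `Σ_k`-formula and `IsQN false k φ` says that `φ` is a
`Π_k`-formula.  In particular `IsQN true 3` captures `∃∀∃`-formulas and `IsQN false 3` captures
`∀∃∀`-formulas. -/
inductive IsQN {L : FirstOrder.Language} {α : Type*} :
    Bool → ℕ → {n : ℕ} → L.BoundedFormula α n → Prop
  | of_isQF {b k n} {φ : L.BoundedFormula α n} : φ.IsQF → IsQN b k φ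
  | of_flip {b k n} {φ : L.BoundedFormula α n} : IsQN (!b) k φ → IsQN b (k + 1) φ
  | ex {k n} {φ : L.BoundedFormula α (n + 1)} : IsQN true (k + 1) φ → IsQN true (k + 1) φ.ex
  | all {k n} {φ : L.BoundedFormula α (n + 1)} : IsQN false (k + 1) φ → IsQN false (k + 1) φ.all

open Ordinal in
/-- Two ordinals are `n`-close if they are equal or have the form `ω ^ n * a + ρ`, `ω ^ n * b + ρ`
with `a, b ≠ 0`. -/
def OrdClose (n : ℕ) (α β : Ordinal.{0}) : Prop :=
  α = β ∨ ∃ a b ρ : Ordinal.{0}, a ≠ 0 ∧ b ≠ 0 ∧ α = ω ^ n * a + ρ ∧ β = ω ^ n * b + ρ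

namespace OrdClose

open Ordinal

variable {n : ℕ} {α β α' β' : Ordinal.{0}}

theorem symm (h : OrdClose n α β) : OrdClose n β α := by
  rcases h with h | ⟨a, b, ρ, ha, hb, h1, h2⟩
  · exact Or.inl h.symm
  · exact Or.inr ⟨b, a, ρ, hb, ha, h2, h1⟩

theorem of_succ (h : OrdClose (n + 1) α β) : OrdClose n α β := by
  rcases h with h | ⟨a, b, ρ, ha, hb, h1, h2⟩
  · exact Or.inl h
  · refine Or.inr ⟨ω * a, ω * b, ρ, mul_ne_zero omega0_ne_zero ha,
      mul_ne_zero omega0_ne_zero hb, ?_, ?_⟩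
    · rw [h1, pow_succ, mul_assoc]
    · rw [h2, pow_succ, mul_assoc]

theorem add_omega_pow_mul {r a : Ordinal.{0}} (hr : r < ω ^ n) (ha : a ≠ 0) :
    r + ω ^ n * a = ω ^ n * a := by
  have h1 : r + ω ^ n = ω ^ n := by
    rw [← opow_natCast] at hr ⊢
    exact add_of_omega0_opow_le hr le_rfl
  have h2 : a = 1 + (a - 1) := (Ordinal.add_sub_cancel_of_le (Order.one_le_iff_pos.2 (pos_iff_ne_zero.2 ha))).symm
  rw [h2, mul_add, mul_one, ← add_assoc, h1]

theorem omega_pow_pos : 0 < (ω : Ordinal.{0}) ^ n := pow_pos omega0_pos n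

theorem exists_add_omega_pow_mul (α : Ordinal.{0}) {a : Ordinal.{0}} (ha : a ≠ 0) :
    ∃ a' ≠ 0, α + ω ^ n * a = ω ^ n * a' := by
  refine ⟨α / ω ^ n + a, by simp [ha], ?_⟩
  conv_lhs => rw [← div_add_mod α (ω ^ n)]
  rw [add_assoc, add_omega_pow_mul (mod_lt _ omega_pow_pos.ne') ha, mul_add]

theorem add (h : OrdClose n α β) (h' : OrdClose n α' β') : OrdClose n (α + α') (β + β') := by
  rcases h' with rfl | ⟨a, b, ρ, ha, hb, rfl, rfl⟩
  · rcases h with rfl | ⟨a, b, ρ, ha, hb, rfl, rfl⟩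
    · exact Or.inl rfl
    · exact Or.inr ⟨a, b, ρ + α', ha, hb, by rw [add_assoc], by rw [add_assoc]⟩
  · obtain ⟨a', ha', h1⟩ := exists_add_omega_pow_mul (n := n) α ha
    obtain ⟨b', hb', h2⟩ := exists_add_omega_pow_mul (n := n) β hb
    exact Or.inr ⟨a', b', ρ, ha', hb', by rw [← add_assoc, h1], by rw [← add_assoc, h2]⟩

theorem eq_zero (h : OrdClose n α β) (hα : α = 0) : β = 0 := by
  rcases h with rfl | ⟨a, b, ρ, ha, hb, h1, h2⟩
  · exact hα
  · have := h1.symm.trans hα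
    simp [ha] at this

/-- A splitting of one of two `(n + 1)`-close ordinals can be copied to the other one. -/
theorem exists_split {δ τ T : Ordinal.{0}} (h : OrdClose (n + 1) (δ + τ) T) :
    ∃ δ' τ', δ' + τ' = T ∧ OrdClose n δ δ' ∧ OrdClose (n + 1) τ τ' := by
  rcases h with rfl | ⟨a, b, ρ, ha, hb, h1, rfl⟩
  · exact ⟨δ, τ, rfl, Or.inl rfl, Or.inl rfl⟩
  rcases le_or_gt (ω ^ (n + 1) * a) δ with hle | hlt
  · obtain ⟨σ, rfl⟩ := exists_add_of_le hle
    rw [add_assoc] at h1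
    have h2 : σ + τ = ρ := by simpa using h1
    refine ⟨ω ^ (n + 1) * b + σ, τ, by rw [add_assoc, h2], ?_, Or.inl rfl⟩
    exact of_succ (Or.inr ⟨a, b, σ, ha, hb, rfl, rfl⟩)
  · have hq : δ / ω ^ (n + 1) < a := by
      by_contra hcon
      exact absurd ((mul_le_mul_right (not_lt.1 hcon) _).trans (mul_div_le δ _)) hlt.not_ge
    obtain ⟨a'', rfl⟩ := exists_add_of_le hq.le
    have ha'' : a'' ≠ 0 := by rintro rfl; simp at hq
    have h2 : δ + (ω ^ (n + 1) * a'' + ρ) = δ + τ := by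
      rw [h1]
      conv_lhs => rw [← div_add_mod δ (ω ^ (n + 1))]
      rw [add_assoc, ← add_assoc (δ % _),
        add_omega_pow_mul (mod_lt _ omega_pow_pos.ne') ha'', mul_add, add_assoc]
    have h3 : ω ^ (n + 1) * a'' + ρ = τ := by simpa using h2
    have key : ∀ δ' < ω ^ (n + 1), OrdClose n δ δ' → ∃ δ' τ', δ' + τ' = ω ^ (n + 1) * b + ρ ∧
        OrdClose n δ δ' ∧ OrdClose (n + 1) τ τ' := fun δ' hδ' hc =>
      ⟨δ', ω ^ (n + 1) * b + ρ, by rw [← add_assoc, add_omega_pow_mul hδ' hb], hc,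
        Or.inr ⟨a'', b, ρ, ha'', hb, h3.symm, rfl⟩⟩
    rcases eq_or_ne (δ / ω ^ n) 0 with h0 | h0
    · refine key δ ?_ (Or.inl rfl)
      have h4 : δ < ω ^ n := by
        rw [← div_add_mod δ (ω ^ n), h0, mul_zero, zero_add]
        exact mod_lt _ omega_pow_pos.ne'
      refine h4.trans_le ?_
      exact pow_le_pow_right₀ (one_lt_omega0).le (Nat.le_succ n)
    · refine key (ω ^ n * 1 + δ % ω ^ n) ?_
        (Or.inr ⟨δ / ω ^ n, 1, δ % ω ^ n, h0, one_ne_zero, (div_add_mod _ _).symm, rfl⟩)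
      calc ω ^ n * 1 + δ % ω ^ n < ω ^ n * 1 + ω ^ n * 1 := by
            gcongr
            simpa using mod_lt _ omega_pow_pos.ne'
        _ = ω ^ n * 2 := by rw [← mul_add, one_add_one_eq_two]
        _ < ω ^ n * ω := by
            gcongr
            · exact omega_pow_pos
            · exact_mod_cast natCast_lt_omega0 2
        _ = ω ^ (n + 1) := (pow_succ _ _).symm

end OrdClose

/-- The pair `q` lies above the pair `p`, with `n`-close differences. -/
def OrdStep (n : ℕ) (p q : Ordinal.{0} × Ordinal.{0}) : Prop :=
  ∃ δ ε, p.1 + δ = q.1 ∧ p.2 + ε = q.2 ∧ OrdClose n δ ε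

/-- A set of pairs of ordinals that is an order isomorphism between its projections, with `n`-close
gaps. -/
def OrdMatch (n : ℕ) (S : Finset (Ordinal.{0} × Ordinal.{0})) : Prop :=
  ∀ p ∈ S, ∀ q ∈ S, OrdStep n p q ∨ OrdStep n q p

namespace OrdStep

variable {n : ℕ} {p q r : Ordinal.{0} × Ordinal.{0}}

theorem refl (n : ℕ) (p : Ordinal.{0} × Ordinal.{0}) : OrdStep n p p :=
  ⟨0, 0, by simp, by simp, Or.inl rfl⟩

theorem trans (h : OrdStep n p q) (h' : OrdStep n q r) : OrdStep n p r := by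
  obtain ⟨a, b, h1, h2, h3⟩ := h
  obtain ⟨c, d, h4, h5, h6⟩ := h'
  exact ⟨a + c, b + d, by rw [← add_assoc, h1, h4], by rw [← add_assoc, h2, h5], h3.add h6⟩

theorem of_succ (h : OrdStep (n + 1) p q) : OrdStep n p q := by
  obtain ⟨a, b, h1, h2, h3⟩ := h
  exact ⟨a, b, h1, h2, h3.of_succ⟩

theorem swap (h : OrdStep n p q) : OrdStep n p.swap q.swap := by
  obtain ⟨a, b, h1, h2, h3⟩ := h
  exact ⟨b, a, h2, h1, h3.symm⟩

theorem fst_le (h : OrdStep n p q) : p.1 ≤ q.1 := by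
  obtain ⟨a, b, h1, h2, h3⟩ := h
  exact h1 ▸ le_self_add

theorem snd_le (h : OrdStep n p q) : p.2 ≤ q.2 := h.swap.fst_le

theorem eq_of_fst_le (h : OrdStep n p q) (hle : q.1 ≤ p.1) : p = q := by
  have h' := h.fst_le
  obtain ⟨a, b, h1, h2, h3⟩ := h
  have ha : a = 0 := by
    have : p.1 + a = p.1 := h1.trans (le_antisymm hle h')
    simpa using this
  have hb := h3.eq_zero ha
  subst ha hb
  exact Prod.ext (by simpa using h1) (by simpa using h2)

end OrdStep

namespace OrdMatch

variable {n : ℕ} {S : Finset (Ordinal.{0} × Ordinal.{0})} {p q : Ordinal.{0} × Ordinal.{0}}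

theorem step (h : OrdMatch n S) (hp : p ∈ S) (hq : q ∈ S) (hle : p.1 ≤ q.1) : OrdStep n p q := by
  rcases h p hp q hq with h1 | h1
  · exact h1
  · rw [h1.eq_of_fst_le hle]; exact OrdStep.refl n p

theorem of_succ (h : OrdMatch (n + 1) S) : OrdMatch n S := fun p hp q hq =>
  (h p hp q hq).imp OrdStep.of_succ OrdStep.of_succ

theorem swap (h : OrdMatch n S) : OrdMatch n (S.image Prod.swap) := by
  intro p hp q hq
  obtain ⟨p', hp', rfl⟩ := Finset.mem_image.1 hp
  obtain ⟨q', hq', rfl⟩ := Finset.mem_image.1 hq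
  exact (h p' hp' q' hq').imp OrdStep.swap OrdStep.swap

/-- Finitely many points can be added to a match at the cost of one level. -/
theorem exists_extend {l : Ordinal.{0}} (h : OrdMatch (n + 1) S) (h0 : (0, 0) ∈ S)
    (hl : (l, l) ∈ S) (G : Finset Ordinal.{0}) (hG : ∀ g ∈ G, g < l) :
    ∃ S', S ⊆ S' ∧ OrdMatch n S' ∧ ∀ g ∈ G, ∃ g', (g, g') ∈ S' := by
  suffices H : ∃ S', S ⊆ S' ∧ OrdMatch n S' ∧ (∀ g ∈ G, ∃ g', (g, g') ∈ S') ∧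
      ∀ p ∈ S', ∀ q ∈ S', (∀ g ∈ G, g ≤ p.1) → p.1 ≤ q.1 → OrdStep (n + 1) p q by
    obtain ⟨S', h1, h2, h3, -⟩ := H
    exact ⟨S', h1, h2, h3⟩
  induction G using Finset.induction_on_max with
  | empty => exact ⟨S, subset_rfl, h.of_succ, by simp, fun p hp q hq _ hle => h.step hp hq hle⟩
  | insert g G hlt ih =>
    obtain ⟨S', hSS', hm, hcov, htail⟩ := ih fun x hx => hG x (Finset.mem_insert_of_mem hx)
    have hgl := hG g (Finset.mem_insert_self _ _)
    obtain ⟨x, hx, hxmax⟩ := Finset.exists_max_image (S'.filter fun p => p.1 ≤ g) Prod.fst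
      ⟨(0, 0), by simp [hSS' h0]⟩
    obtain ⟨y, hy, hymin⟩ := Finset.exists_min_image (S'.filter fun p => g < p.1) Prod.fst
      ⟨(l, l), by simp [hSS' hl, hgl]⟩
    simp only [Finset.mem_filter] at hx hy hxmax hymin
    have hxG : ∀ g' ∈ G, g' ≤ x.1 := by
      intro g' hg'
      obtain ⟨k, hk⟩ := hcov g' hg'
      exact hxmax (g', k) ⟨hk, (hlt g' hg').le⟩
    obtain ⟨T, T', hT, hT', hTT'⟩ := htail x hx.1 y hy.1 hxG (hx.2.trans hy.2.le)
    obtain ⟨δ, hδ⟩ := exists_add_of_le hx.2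
    obtain ⟨τ, hτ⟩ := exists_add_of_le hy.2.le
    have hsum : δ + τ = T := by
      have : x.1 + (δ + τ) = x.1 + T := by rw [← add_assoc, ← hδ, ← hτ, hT]
      simpa using this
    rw [← hsum] at hTT'
    obtain ⟨δ', τ', hsum', hδδ', hττ'⟩ := hTT'.exists_split
    have hstep1 : OrdStep n x (g, x.2 + δ') := ⟨δ, δ', hδ.symm, rfl, hδδ'⟩
    have hstep2 : OrdStep (n + 1) (g, x.2 + δ') y :=
      ⟨τ, τ', hτ.symm, by rw [add_assoc, hsum', hT'], hττ'⟩
    have hbelow : ∀ p ∈ S', p.1 ≤ g → OrdStep n p (g, x.2 + δ') := fun p hp hpg =>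
      (hm.step hp hx.1 (hxmax p ⟨hp, hpg⟩)).trans hstep1
    have habove : ∀ p ∈ S', g < p.1 → OrdStep (n + 1) (g, x.2 + δ') p := fun p hp hpg =>
      hstep2.trans (htail y hy.1 p hp (fun g' hg' => ((hlt g' hg').trans hy.2).le)
        (hymin p ⟨hp, hpg⟩))
    have hall : ∀ p ∈ S', OrdStep n p (g, x.2 + δ') ∨ OrdStep n (g, x.2 + δ') p := by
      intro p hp
      rcases le_or_gt p.1 g with hc | hc
      · exact Or.inl (hbelow p hp hc)
      · exact Or.inr (habove p hp hc).of_succ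
    refine ⟨insert (g, x.2 + δ') S', hSS'.trans (Finset.subset_insert _ _), ?_, ?_, ?_⟩
    · intro p hp q hq
      rcases Finset.mem_insert.1 hp with rfl | hp <;> rcases Finset.mem_insert.1 hq with rfl | hq
      · exact Or.inl (OrdStep.refl _ _)
      · exact (hall q hq).symm
      · exact hall p hp
      · exact hm p hp q hq
    · intro g' hg'
      rcases Finset.mem_insert.1 hg' with rfl | hg'
      · exact ⟨_, Finset.mem_insert_self _ _⟩
      · obtain ⟨k, hk⟩ := hcov g' hg'
        exact ⟨k, Finset.mem_insert_of_mem hk⟩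
    · intro p hp q hq hGp hpq
      have hgp := hGp g (Finset.mem_insert_self _ _)
      have hold : ∀ p ∈ S', ∀ q ∈ S', g ≤ p.1 → p.1 ≤ q.1 → OrdStep (n + 1) p q :=
        fun p hp q hq hgp hpq =>
          htail p hp q hq (fun g' hg' => ((hlt g' hg').trans_le hgp).le) hpq
      have heq : ∀ p ∈ S', p.1 = g → p = (g, x.2 + δ') := fun p hp hpg =>
        (hbelow p hp hpg.le).eq_of_fst_le hpg.ge
      rcases Finset.mem_insert.1 hp with rfl | hp <;> rcases Finset.mem_insert.1 hq with rfl | hq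
      · exact OrdStep.refl _ _
      · rcases hpq.lt_or_eq with hc | hc
        · exact habove q hq hc
        · rw [heq q hq hc.symm]; exact OrdStep.refl _ _
      · rw [heq p hp (le_antisymm hpq hgp)]; exact OrdStep.refl _ _
      · exact hold p hp q hq hgp hpq

end OrdMatch

open Ordinal in
/-- The index set: the well-order `ω ^ 4`. -/
abbrev Idx : Type := ((ω : Ordinal.{0}) ^ 4).ToType

namespace Idx

open Ordinal

/-- The position of an index as an ordinal. -/
noncomputable def rank (i : Idx) : Ordinal.{0} := (ToType.mk.symm i).1

theorem rank_lt (i : Idx) : i.rank < ω ^ 4 := (ToType.mk.symm i).2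

theorem rank_lt_rank {i j : Idx} : i.rank < j.rank ↔ i < j :=
  ToType.mk.symm.lt_iff_lt

theorem rank_le_rank {i j : Idx} : i.rank ≤ j.rank ↔ i ≤ j :=
  ToType.mk.symm.le_iff_le

theorem exists_rank_eq {α : Ordinal.{0}} (h : α < ω ^ 4) : ∃ i : Idx, i.rank = α :=
  ⟨ToType.mk ⟨α, h⟩, by simp [rank]⟩

/-- Two finite subsets of the index set are `n`-matched if the gaps between consecutive points are
`n`-close. -/
def Matched (n : ℕ) {M : Type} [LinearOrder M] (u v : M ↪o Idx) : Prop :=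
  ∃ S, OrdMatch n S ∧ (0, 0) ∈ S ∧ (ω ^ 4, ω ^ 4) ∈ S ∧ ∀ i, ((u i).rank, (v i).rank) ∈ S

namespace Matched

variable {n : ℕ} {M M' : Type} [LinearOrder M] [LinearOrder M'] {u v : M ↪o Idx}

theorem symm (h : Matched n u v) : Matched n v u := by
  obtain ⟨S, h1, h2, h3, h4⟩ := h
  refine ⟨S.image Prod.swap, h1.swap, ?_, ?_, fun i => ?_⟩
  · exact Finset.mem_image_of_mem Prod.swap h2
  · exact Finset.mem_image_of_mem Prod.swap h3
  · exact Finset.mem_image_of_mem Prod.swap (h4 i)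

theorem exists_extend [Finite M'] (h : Matched (n + 1) u v) (e : M ↪o M') (u' : M' ↪o Idx)
    (hu : ∀ i, u' (e i) = u i) :
    ∃ v' : M' ↪o Idx, (∀ i, v' (e i) = v i) ∧ Matched n u' v' := by
  have := Fintype.ofFinite M'
  obtain ⟨S, h1, h2, h3, h4⟩ := h
  obtain ⟨S', hSS', hm, hcov⟩ := h1.exists_extend h2 h3 (Finset.univ.image fun i => (u' i).rank)
    (by simp [rank_lt])
  have hcov' : ∀ i, ∃ k : Idx, ((u' i).rank, k.rank) ∈ S' := by
    intro i
    obtain ⟨g, hg⟩ := hcov (u' i).rank (by simp)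
    have hst := hm.step hg (hSS' h3) (rank_lt _).le
    have hlt : g < ω ^ 4 := by
      refine lt_of_le_of_ne hst.snd_le ?_
      rintro rfl
      have := hst.swap.eq_of_fst_le le_rfl
      simp only [Prod.swap_prod_mk, Prod.mk.injEq, true_and] at this
      exact (rank_lt _).ne this
    obtain ⟨k, rfl⟩ := exists_rank_eq hlt
    exact ⟨k, hg⟩
  choose f hf using hcov'
  have hmono : StrictMono f := by
    intro i j hij
    have hij' : (u' i).rank < (u' j).rank := rank_lt_rank.2 (u'.lt_iff_lt.2 hij)
    have hst := hm.step (hf i) (hf j) hij'.le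
    refine lt_of_le_of_ne (rank_le_rank.1 hst.snd_le) fun heq => ?_
    have := hst.swap.eq_of_fst_le (by simp [heq])
    simp only [Prod.swap_prod_mk, Prod.mk.injEq] at this
    exact hij'.ne this.2
  refine ⟨OrderEmbedding.ofStrictMono f hmono, fun i => ?_,
    ⟨S', hm, hSS' h2, hSS' h3, hf⟩⟩
  have h5 := hSS' (h4 i)
  have h6 := hf (e i)
  rw [hu] at h6
  have h7 := (hm.step h5 h6 le_rfl).eq_of_fst_le le_rfl
  simp only [Prod.mk.injEq, true_and] at h7
  exact le_antisymm (rank_le_rank.1 h7.ge) (rank_le_rank.1 h7.le)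

end Matched

/-- Iterated limits: an index is an `(n + 1)`-fold limit if it is a limit of `n`-fold limits (or
minimal). -/
def IsLim : ℕ → Idx → Prop
  | 0, _ => True
  | n + 1, x => ∀ y < x, ∃ z, y < z ∧ z < x ∧ IsLim n z

theorem isLim_iff {n : ℕ} {x : Idx} : IsLim n x ↔ ω ^ n ∣ x.rank := by
  induction n generalizing x with
  | zero => simp [IsLim]
  | succ n ih =>
    have hpos : (ω : Ordinal.{0}) ^ n ≠ 0 := (pow_pos omega0_pos n).ne'
    simp only [IsLim, ih]
    constructor
    · intro h
      have h1 : ω ^ n ∣ x.rank := by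
        have hle : ω ^ n * (x.rank / ω ^ n) ≤ x.rank := mul_div_le _ _
        rcases hle.lt_or_eq with hlt | heq
        · obtain ⟨y, hy⟩ := exists_rank_eq (hlt.trans x.rank_lt)
          obtain ⟨z, hyz, hzx, w, hw⟩ := h y (rank_lt_rank.1 (hy ▸ hlt))
          have h2 : w ≤ x.rank / ω ^ n := by
            rw [← Ordinal.mul_le_iff_le_div hpos, ← hw]
            exact (rank_lt_rank.2 hzx).le
          have h3 := rank_lt_rank.2 hyz
          rw [hy, hw] at h3
          exact absurd (mul_le_mul_right h2 _) h3.not_ge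
        · exact ⟨_, heq.symm⟩
      obtain ⟨w, hw⟩ := h1
      rw [hw, pow_succ]
      refine mul_dvd_mul_left _ ?_
      rw [← isSuccPrelimit_iff_omega0_dvd]
      intro w' hw'
      have hww : w = Order.succ w' := (Order.succ_eq_of_covBy hw').symm
      have hlt : ω ^ n * w' < x.rank := by
        rw [hw]; exact (mul_lt_mul_iff_right₀ (pos_iff_ne_zero.2 hpos)).2 hw'.lt
      obtain ⟨y, hy⟩ := exists_rank_eq (hlt.trans x.rank_lt)
      obtain ⟨z, hyz, hzx, k, hk⟩ := h y (rank_lt_rank.1 (hy ▸ hlt))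
      have h3 := rank_lt_rank.2 hyz
      have h4 := rank_lt_rank.2 hzx
      rw [hy, hk] at h3
      rw [hk, hw] at h4
      have h5 := lt_of_mul_lt_mul_left' h3
      have h6 := lt_of_mul_lt_mul_left' h4
      exact hw'.2 h5 h6
    · rintro ⟨w, hw⟩ y hy
      rw [pow_succ, mul_assoc] at hw
      have hy' := rank_lt_rank.2 hy
      have h1 : y.rank / ω ^ n < ω * w := by
        rw [← Ordinal.lt_mul_iff_div_lt hpos, ← hw]; exact hy'
      have h2 : Order.succ (y.rank / ω ^ n) < ω * w :=
        (isSuccPrelimit_iff_omega0_dvd.2 (dvd_mul_right ω w)).succ_lt h1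
      have h3 : ω ^ n * Order.succ (y.rank / ω ^ n) < x.rank := by
        rw [hw]; exact (mul_lt_mul_iff_right₀ (pos_iff_ne_zero.2 hpos)).2 h2
      obtain ⟨z, hz⟩ := exists_rank_eq (h3.trans x.rank_lt)
      refine ⟨z, ?_, ?_, ?_⟩
      · rw [← rank_lt_rank, hz]; exact lt_mul_succ_div _ hpos
      · rw [← rank_lt_rank, hz]; exact h3
      · exact ⟨_, hz⟩

theorem omega_pow_three_mul_lt (m : ℕ) : (ω : Ordinal.{0}) ^ 3 * m < ω ^ 4 := by
  rw [pow_succ ω 3]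
  exact (mul_lt_mul_iff_right₀ (pow_pos omega0_pos 3)).2 (natCast_lt_omega0 m)

/-- The index `ω ^ 3 * m`. -/
noncomputable def threePow (m : ℕ) : Idx :=
  (exists_rank_eq (omega_pow_three_mul_lt m)).choose

theorem rank_threePow (m : ℕ) : (threePow m).rank = ω ^ 3 * m :=
  (exists_rank_eq (omega_pow_three_mul_lt m)).choose_spec

theorem threePow_strictMono : StrictMono threePow := fun m n h => by
  rw [← rank_lt_rank, rank_threePow, rank_threePow]
  exact (mul_lt_mul_iff_right₀ (pow_pos omega0_pos 3)).2 (by exact_mod_cast h)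

theorem isLim_threePow (m : ℕ) : IsLim 3 (threePow m) :=
  isLim_iff.2 ⟨m, rank_threePow m⟩

theorem threePow_one_le {x y : Idx} (h : IsLim 3 x) (hy : y < x) : threePow 1 ≤ x := by
  rw [← rank_le_rank, rank_threePow, Nat.cast_one, mul_one]
  have hy' := rank_lt_rank.2 hy
  exact Ordinal.le_of_dvd (by rintro h0; rw [h0] at hy'; exact not_lt_zero hy') (isLim_iff.1 h)

theorem exists_gt (x : Idx) : ∃ y, x < y := by
  have h : Order.succ x.rank < ω ^ 4 := by
    have : Order.IsSuccPrelimit ((ω : Ordinal.{0}) ^ 4) := by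
      rw [isSuccPrelimit_iff_omega0_dvd, pow_succ']
      exact dvd_mul_right _ _
    exact this.succ_lt x.rank_lt
  obtain ⟨y, hy⟩ := exists_rank_eq h
  exact ⟨y, by rw [← rank_lt_rank, hy]; exact Order.lt_succ _⟩

/-- The order embedding of a one-point order with a given value. -/
noncomputable def point (i : Idx) : Unit ↪o Idx :=
  OrderEmbedding.ofStrictMono (fun _ => i) (Subsingleton.strictMono _)

theorem matched_threePow :
    Matched 3 (point (threePow 1)) (point (threePow 2)) := by
  refine ⟨{(0, 0), (ω ^ 3, ω ^ 3 * 2), (ω ^ 4, ω ^ 4)}, ?_, by simp, by simp, fun i => ?_⟩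
  · have h1 : OrdStep 3 (0, 0) (ω ^ 3, ω ^ 3 * 2) :=
      ⟨ω ^ 3, ω ^ 3 * 2, zero_add _, zero_add _,
        Or.inr ⟨1, 2, 0, one_ne_zero, two_ne_zero, by simp, by simp⟩⟩
    have h2 : OrdStep 3 (ω ^ 3, ω ^ 3 * 2) (ω ^ 4, ω ^ 4) := by
      refine ⟨ω ^ 4, ω ^ 4, ?_, ?_, Or.inl rfl⟩
      · have := OrdClose.add_omega_pow_mul (n := 4) (r := ω ^ 3) (a := 1)
          (by simpa using omega_pow_three_mul_lt 1) one_ne_zero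
        simpa using this
      · have := OrdClose.add_omega_pow_mul (n := 4) (r := ω ^ 3 * 2) (a := 1)
          (by simpa using omega_pow_three_mul_lt 2) one_ne_zero
        simpa using this
    intro p hp q hq
    simp only [Finset.mem_insert, Finset.mem_singleton] at hp hq
    rcases hp with rfl | rfl | rfl <;> rcases hq with rfl | rfl | rfl
    · exact Or.inl (OrdStep.refl _ _)
    · exact Or.inl h1
    · exact Or.inl (h1.trans h2)
    · exact Or.inr h1
    · exact Or.inl (OrdStep.refl _ _)
    · exact Or.inl h2
    · exact Or.inr (h1.trans h2)
    · exact Or.inr h2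
    · exact Or.inl (OrdStep.refl _ _)
  · have h1 := rank_threePow 1
    have h2 := rank_threePow 2
    simp only [Nat.cast_one, mul_one, Nat.cast_ofNat] at h1 h2
    change ((threePow 1).rank, (threePow 2).rank) ∈ _
    simp [h1, h2]

end Idx

namespace HahnHensel

open HahnSeries Polynomial

variable {Γ R : Type*} [AddCommMonoid Γ] [LinearOrder Γ]

/-- Sums of at least `n` positive elements of `T`. -/
def level (T : AddSubmonoid Γ) : ℕ → Set Γ
  | 0 => T
  | n + 1 => {g | ∃ a ∈ T, 0 < a ∧ ∃ b ∈ level T n, a + b = g}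

variable {T : AddSubmonoid Γ}

theorem add_mem_level {n : ℕ} {a b : Γ} (ha : a ∈ T) (hb : b ∈ level T n) :
    a + b ∈ level T n := by
  induction n generalizing a b with
  | zero => exact T.add_mem ha hb
  | succ n ih =>
    obtain ⟨c, hc, hc0, d, hd, rfl⟩ := hb
    exact ⟨c, hc, hc0, a + d, ih ha hd, by rw [add_left_comm]⟩

theorem level_succ_subset (n : ℕ) : level T (n + 1) ⊆ level T n := by
  rintro g ⟨a, ha, -, b, hb, rfl⟩
  exact add_mem_level ha hb

theorem level_antitone : Antitone (level T) := antitone_nat_of_succ_le level_succ_subset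

variable [IsOrderedCancelAddMonoid Γ] [CommRing R]

/-- The Hahn series supported in a given submonoid. -/
def supportedIn (R : Type*) [CommRing R] (T : AddSubmonoid Γ) : Subring (HahnSeries Γ R) where
  carrier := {x | x.support ⊆ T}
  mul_mem' {x y} hx hy := by
    intro g hg
    obtain ⟨a, ha, b, hb, rfl⟩ := support_mul_subset hg
    exact T.add_mem (hx ha) (hy hb)
  one_mem' := by
    intro g hg
    have : g = 0 := by
      rw [← HahnSeries.single_zero_one] at hg
      exact eq_of_mem_support_single hg
    exact this ▸ T.zero_mem
  add_mem' {x y} hx hy := (support_add_subset x y).trans (Set.union_subset hx hy)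
  zero_mem' := by simp
  neg_mem' {x} hx := by simpa using hx

theorem exists_notMem_level (hT : (T : Set Γ).IsPWO) (g : Γ) :
    ∃ n, g ∉ level T n := by
  by_cases hg : g ∈ T
  swap
  · exact ⟨0, hg⟩
  refine hT.isWF.induction hg (P := fun g => ∃ n, g ∉ level T n) ?_
  intro g hg ih
  have hfin := Set.AddAntidiagonal.finite_of_isPWO hT hT g
  have ih' : ∀ p : Γ × Γ, ∃ n, p ∈ Set.antidiagonal (T : Set Γ) T g → p.2 < g →
      p.2 ∉ level T n := by
    intro p
    by_cases hp : p ∈ Set.antidiagonal (T : Set Γ) T g ∧ p.2 < g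
    · obtain ⟨n, hn⟩ := ih p.2 hp.1.2.1 hp.2
      exact ⟨n, fun _ _ => hn⟩
    · exact ⟨0, fun h1 h2 => absurd ⟨h1, h2⟩ hp⟩
  choose N hN using ih'
  refine ⟨hfin.toFinset.sup N + 1, ?_⟩
  rintro ⟨a, ha, ha0, b, hb, hab⟩
  have hbT : b ∈ T := level_antitone (Nat.zero_le _) hb
  have hp : (a, b) ∈ Set.antidiagonal (T : Set Γ) T g := ⟨ha, hbT, hab⟩
  refine hN (a, b) hp ?_ (level_antitone (Finset.le_sup (f := N) (hfin.mem_toFinset.2 hp)) hb)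
  rw [← hab]
  exact lt_add_of_pos_left b ha0

/-- Hahn series supported on the sums of at least `n` positive elements of `T`. -/
def InLevel (T : AddSubmonoid Γ) (n : ℕ) (x : HahnSeries Γ R) : Prop := x.support ⊆ level T n

theorem InLevel.mul {n : ℕ} {x y : HahnSeries Γ R} (hx : InLevel T n x)
    (hy : y ∈ supportedIn R T) (hy0 : ∀ g ∈ y.support, 0 < g) : InLevel T (n + 1) (x * y) := by
  intro g hg
  obtain ⟨a, ha, b, hb, rfl⟩ := support_mul_subset hg
  exact ⟨b, hy hb, hy0 b hb, a, hx ha, add_comm _ _⟩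

/-- The ideal of series with positive support. -/
def positiveIdeal (hT0 : ∀ g ∈ T, 0 ≤ g) : Ideal (supportedIn R T) where
  carrier := {x | ∀ g ∈ x.1.support, 0 < g}
  add_mem' {x y} hx hy g hg := by
    rcases support_add_subset x.1 y.1 hg with h | h
    · exact hx g h
    · exact hy g h
  zero_mem' := by simp
  smul_mem' c x hx g hg := by
    obtain ⟨a, ha, b, hb, rfl⟩ := support_mul_subset (x := c.1) (y := x.1) hg
    exact add_pos_of_nonneg_of_pos (hT0 a (c.2 ha)) (hx b hb)

theorem exists_root_supportedIn (hT : (T : Set Γ).IsPWO) (hT0 : ∀ g ∈ T, 0 ≤ g)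
    (w : supportedIn R T) (hw : ∀ g ∈ w.1.support, 0 < g) (G : (supportedIn R T)[X]) :
    ∃ y : supportedIn R T, (∀ g ∈ y.1.support, 0 < g) ∧ w + y + y ^ 2 * G.eval y = 0 := by
  classical
  let J : Ideal (supportedIn R T) := positiveIdeal hT0
  let Φ : supportedIn R T → supportedIn R T := fun y => -w - y ^ 2 * G.eval y
  have hΦJ : ∀ y ∈ J, Φ y ∈ J := fun y hy =>
    J.sub_mem (J.neg_mem hw) (by rw [pow_two, mul_assoc]; exact J.mul_mem_right _ hy)
  have hΦ : ∀ n, ∀ y ∈ J, ∀ z ∈ J, InLevel T n (y - z).1 → InLevel T (n + 1) (Φ y - Φ z).1 := by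
    intro n y hy z hz hyz
    obtain ⟨q, hq⟩ := sub_dvd_eval_sub y z G
    have h1 : Φ y - Φ z = (y - z) * -((y + z) * G.eval y + z ^ 2 * q) := by
      simp only [Φ]
      linear_combination (-z ^ 2) * hq
    have h2 : -((y + z) * G.eval y + z ^ 2 * q) ∈ J := by
      refine J.neg_mem (J.add_mem (J.mul_mem_right _ (J.add_mem hy hz)) ?_)
      rw [pow_two, mul_assoc]
      exact J.mul_mem_right _ hz
    rw [h1]
    exact hyz.mul (Subtype.property _) h2
  let Y : ℕ → supportedIn R T := fun n => Φ^[n] 0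
  have hYs : ∀ n, Y (n + 1) = Φ (Y n) := fun n => Function.iterate_succ_apply' Φ n 0
  have hYJ : ∀ n, Y n ∈ J := by
    intro n
    induction n with
    | zero => exact J.zero_mem
    | succ n ih => rw [hYs]; exact hΦJ _ ih
  have hD : ∀ n, InLevel T n (Y (n + 1) - Y n).1 := by
    intro n
    induction n with
    | zero => exact (Y 1 - Y 0).2
    | succ n ih =>
      rw [hYs (n + 1), hYs n]
      rw [hYs n] at ih
      exact hΦ n _ (hΦJ _ (hYJ n)) _ (hYJ n) ih
  have hstab : ∀ g n, g ∉ level T n → ∀ m, n ≤ m → (Y m).1.coeff g = (Y n).1.coeff g := by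
    intro g n hg m hm
    induction m, hm using Nat.le_induction with
    | base => rfl
    | succ m hm ih =>
      have h1 : (Y (m + 1) - Y m).1.coeff g = 0 := by
        by_contra hcon
        exact hg (level_antitone hm (hD m hcon))
      rw [← ih]
      simpa [sub_eq_zero] using h1
  choose N hN using exists_notMem_level hT
  have hsupp : (Function.support fun g => (Y (N g)).1.coeff g) ⊆ T :=
    fun g hg => (Y (N g)).2 hg
  let y : supportedIn R T :=
    ⟨⟨fun g => (Y (N g)).1.coeff g, hT.mono hsupp⟩, hsupp⟩
  have hyJ : y ∈ J := fun g hg => hYJ (N g) g hg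
  have hyY : ∀ n, InLevel T n (y - Y n).1 := by
    intro n g hg
    by_contra hcon
    apply hg
    have h1 := hstab g n hcon _ (le_max_left n (N g))
    have h2 := hstab g (N g) (hN g) _ (le_max_right n (N g))
    change (Y (N g)).1.coeff g - (Y n).1.coeff g = 0
    rw [← h1, ← h2, sub_self]
  have hfix : Φ y - y = 0 := by
    ext g
    by_contra hcon
    have h1 := hΦ (N g) y hyJ _ (hYJ (N g)) (hyY (N g))
    rw [← hYs] at h1
    have h2 := hyY (N g + 1)
    have h3 : (Φ y - y).1 = (Φ y - Y (N g + 1)).1 - (y - Y (N g + 1)).1 := by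
      push_cast; ring
    rw [h3] at hcon
    have h4 : g ∈ ((Φ y - Y (N g + 1)).1 - (y - Y (N g + 1)).1).support := hcon
    rw [sub_eq_add_neg] at h4
    apply hN g (level_succ_subset _ _)
    rcases support_add_subset _ _ h4 with h | h
    · exact h1 h
    · rw [HahnSeries.support_neg] at h; exact h2 h
  refine ⟨y, hyJ, ?_⟩
  simp only [Φ] at hfix
  linear_combination -hfix

/-- A Hensel-type statement for Hahn series with nonnegative support. -/
theorem exists_root (w : HahnSeries Γ R) (hw : ∀ g ∈ w.support, 0 < g) (G : (HahnSeries Γ R)[X])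
    (hG : ∀ i, ∀ g ∈ (G.coeff i).support, 0 ≤ g) :
    ∃ y : HahnSeries Γ R, (∀ g ∈ y.support, 0 < g) ∧ w + y + y ^ 2 * G.eval y = 0 := by
  let S : Set Γ := w.support ∪ ⋃ i ∈ G.support, (G.coeff i).support
  have hS0 : ∀ g ∈ S, 0 ≤ g := by
    rintro g (hg | hg)
    · exact (hw g hg).le
    · simp only [Set.mem_iUnion] at hg
      obtain ⟨i, -, hg⟩ := hg
      exact hG i g hg
  have hS : S.IsPWO := by
    refine w.isPWO_support.union ?_
    exact (Finset.isPWO_bUnion G.support).2 fun i _ => (G.coeff i).isPWO_support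
  let T := AddSubmonoid.closure S
  have hT : (T : Set Γ).IsPWO := hS.addSubmonoid_closure hS0
  have hT0 : ∀ g ∈ T, 0 ≤ g := by
    intro g hg
    induction hg using AddSubmonoid.closure_induction with
    | mem g hg => exact hS0 g hg
    | zero => exact le_rfl
    | add a b _ _ ha hb => exact add_nonneg ha hb
  have hwT : w ∈ supportedIn R T := fun g hg => AddSubmonoid.subset_closure (Or.inl hg)
  have hGT : G ∈ Polynomial.lifts (supportedIn R T).subtype := by
    rw [Polynomial.lifts_iff_coeff_lifts]
    intro i
    refine ⟨⟨G.coeff i, fun g hg => AddSubmonoid.subset_closure (Or.inr ?_)⟩, rfl⟩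
    simp only [Set.mem_iUnion]
    refine ⟨i, ?_, hg⟩
    rw [Polynomial.mem_support_iff]
    intro h0
    rw [h0] at hg
    simp at hg
  obtain ⟨G', hG'⟩ := hGT
  obtain ⟨y, hy0, hy⟩ := exists_root_supportedIn hT hT0 ⟨w, hwT⟩ hw G'
  refine ⟨y.1, hy0, ?_⟩
  have h1 := congrArg (supportedIn R T).subtype hy
  simp only [map_add, map_mul, map_pow, map_zero] at h1
  have h2 : G.eval y.1 = (supportedIn R T).subtype (G'.eval y) := by
    rw [← hG']
    exact Polynomial.eval_map_apply (f := (supportedIn R T).subtype) y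
  rw [h2]
  exact h1

end HahnHensel

/-- The exponent group: finitely supported integer vectors, ordered lexicographically. -/
abbrev Expo (M : Type) [LinearOrder M] : Type := Lex (M →₀ ℤ)

namespace Expo

variable {M N N₂ : Type} [LinearOrder M] [LinearOrder N] [LinearOrder N₂]

/-- The exponent with prescribed finitely supported coordinates concentrated at one index. -/
noncomputable def single (i : M) (n : ℤ) : Expo M := toLex (Finsupp.single i n)

/-- A coordinate of an exponent. -/
def at' (g : Expo M) (i : M) : ℤ := ofLex g i

theorem ext {g h : Expo M} (H : ∀ i, g.at' i = h.at' i) : g = h :=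
  ofLex.injective (Finsupp.ext H)

@[simp] theorem at'_add (g h : Expo M) (i : M) : (g + h).at' i = g.at' i + h.at' i := rfl

@[simp] theorem at'_neg (g : Expo M) (i : M) : (-g).at' i = -g.at' i := rfl

@[simp] theorem at'_sub (g h : Expo M) (i : M) : (g - h).at' i = g.at' i - h.at' i := rfl

@[simp] theorem at'_zero (i : M) : (0 : Expo M).at' i = 0 := rfl

@[simp] theorem at'_single_self (i : M) (n : ℤ) : (single i n).at' i = n := by
  simp [single, at']

theorem at'_single_of_ne {i j : M} (h : i ≠ j) (n : ℤ) : (single i n).at' j = 0 := by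
  simp [single, at', h]

theorem lt_iff {g h : Expo M} :
    g < h ↔ ∃ i, (∀ j < i, g.at' j = h.at' j) ∧ g.at' i < h.at' i :=
  Finsupp.Lex.lt_iff

/-- Exponents are functorial in the index order. -/
noncomputable def map (u : M ↪o N) : Expo M →+ Expo N where
  toFun g := toLex (Finsupp.embDomain u.toEmbedding (ofLex g))
  map_zero' := by simp
  map_add' g h := by
    simp [Finsupp.embDomain_add]

@[simp] theorem map_at' (u : M ↪o N) (g : Expo M) (i : M) : (map u g).at' (u i) = g.at' i :=
  Finsupp.embDomain_apply_self u.toEmbedding (ofLex g) i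

theorem map_at'_of_notMem (u : M ↪o N) (g : Expo M) {i : N} (hi : i ∉ Set.range u) :
    (map u g).at' i = 0 :=
  Finsupp.embDomain_of_notMem_range u.toEmbedding (ofLex g) i hi

theorem map_map (v : N ↪o N₂) (u : M ↪o N) (w : M ↪o N₂) (h : ∀ i, v (u i) = w i) (g : Expo M) :
    map v (map u g) = map w g := by
  refine ext fun i => ?_
  by_cases hi : i ∈ Set.range w
  · obtain ⟨i, rfl⟩ := hi
    rw [map_at', ← h, map_at', map_at']
  · rw [map_at'_of_notMem w g hi]
    by_cases hi' : i ∈ Set.range v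
    · obtain ⟨i, rfl⟩ := hi'
      rw [map_at', map_at'_of_notMem]
      rintro ⟨j, rfl⟩
      exact hi ⟨j, (h j).symm⟩
    · exact map_at'_of_notMem _ _ hi'

theorem map_strictMono (u : M ↪o N) : StrictMono (map u) := by
  intro g h hgh
  obtain ⟨i, hi, hi'⟩ := lt_iff.1 hgh
  refine lt_iff.2 ⟨u i, fun j hj => ?_, by simpa using hi'⟩
  by_cases hj' : j ∈ Set.range u
  · obtain ⟨j, rfl⟩ := hj'
    simpa using hi j (u.lt_iff_lt.1 hj)
  · rw [map_at'_of_notMem _ _ hj', map_at'_of_notMem _ _ hj']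

theorem map_single (u : M ↪o N) (i : M) (n : ℤ) : map u (single i n) = single (u i) n := by
  refine ext fun j => ?_
  by_cases hj : j = u i
  · subst hj; simp
  · rw [at'_single_of_ne (Ne.symm hj)]
    by_cases hj' : j ∈ Set.range u
    · obtain ⟨j, rfl⟩ := hj'
      rw [map_at', at'_single_of_ne]
      rintro rfl
      exact hj rfl
    · exact map_at'_of_notMem _ _ hj'

theorem exists_half {g : Expo M} (h : ∀ i, Even (g.at' i)) : ∃ d : Expo M, g = d + d := by
  classical
  refine ⟨toLex ((ofLex g).mapRange (fun n : ℤ => n / 2) (by simp)), ext fun i => ?_⟩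
  rw [at'_add]
  change g.at' i = g.at' i / 2 + g.at' i / 2
  obtain ⟨k, hk⟩ := h i
  omega

end Expo

/-- The Hahn series field over `ℂ` with exponents indexed by `M`. -/
abbrev Ser (M : Type) [LinearOrder M] : Type := HahnSeries (Expo M) ℂ

namespace Ser

variable {M N N₂ : Type} [LinearOrder M] [LinearOrder N] [LinearOrder N₂]

/-- Hahn series are functorial in the index order. -/
noncomputable def map (u : M ↪o N) : Ser M →+* Ser N :=
  HahnSeries.embDomainRingHom (Expo.map u) (Expo.map_strictMono u).injective
    fun _ _ => (Expo.map_strictMono u).le_iff_le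

theorem coeff_map (u : M ↪o N) (x : Ser M) (g : Expo M) :
    (map u x).coeff (Expo.map u g) = x.coeff g :=
  HahnSeries.embDomain_coeff (f := ⟨⟨Expo.map u, (Expo.map_strictMono u).injective⟩,
    (Expo.map_strictMono u).le_iff_le⟩)

theorem coeff_map_of_notMem (u : M ↪o N) (x : Ser M) {g : Expo N}
    (hg : g ∉ Set.range (Expo.map u)) : (map u x).coeff g = 0 :=
  HahnSeries.embDomain_of_notMem_range (f := ⟨⟨Expo.map u, (Expo.map_strictMono u).injective⟩,
    (Expo.map_strictMono u).le_iff_le⟩) hg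

theorem map_map (v : N ↪o N₂) (u : M ↪o N) (w : M ↪o N₂) (h : ∀ i, v (u i) = w i) (x : Ser M) :
    map v (map u x) = map w x := by
  ext g
  by_cases hg : g ∈ Set.range (Expo.map w)
  · obtain ⟨g, rfl⟩ := hg
    rw [coeff_map, ← Expo.map_map v u w h, coeff_map, coeff_map]
  · rw [coeff_map_of_notMem w x hg]
    by_cases hg' : g ∈ Set.range (Expo.map v)
    · obtain ⟨g, rfl⟩ := hg'
      rw [coeff_map, coeff_map_of_notMem]
      rintro ⟨g, rfl⟩
      exact hg ⟨g, (Expo.map_map v u w h g).symm⟩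
    · exact coeff_map_of_notMem _ _ hg'

theorem map_single (u : M ↪o N) (g : Expo M) (r : ℂ) :
    map u (HahnSeries.single g r) = HahnSeries.single (Expo.map u g) r :=
  HahnSeries.embDomain_single (f := ⟨⟨Expo.map u, (Expo.map_strictMono u).injective⟩,
    (Expo.map_strictMono u).le_iff_le⟩)

theorem forall_mem_support_map (u : M ↪o N) (x : Ser M) (P : Expo N → Prop) :
    (∀ g ∈ (map u x).support, P g) ↔ ∀ g ∈ x.support, P (Expo.map u g) := by
  constructor
  · intro h g hg
    exact h _ (by rwa [HahnSeries.mem_support, coeff_map])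
  · intro h g hg
    by_cases hg' : g ∈ Set.range (Expo.map u)
    · obtain ⟨g, rfl⟩ := hg'
      rw [HahnSeries.mem_support, coeff_map] at hg
      exact h g hg
    · exact absurd (coeff_map_of_notMem u x hg') hg

theorem pos_map_iff (u : M ↪o N) (x : Ser M) :
    (∀ g ∈ (map u x).support, 0 < g) ↔ ∀ g ∈ x.support, 0 < g := by
  rw [forall_mem_support_map]
  refine forall₂_congr fun g _ => ?_
  rw [← map_zero (Expo.map u), (Expo.map_strictMono u).lt_iff_lt]

theorem nonneg_map_iff (u : M ↪o N) (x : Ser M) :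
    (∀ g ∈ (map u x).support, 0 ≤ g) ↔ ∀ g ∈ x.support, 0 ≤ g := by
  rw [forall_mem_support_map]
  refine forall₂_congr fun g _ => ?_
  rw [← map_zero (Expo.map u), (Expo.map_strictMono u).le_iff_le]

theorem order_map (u : M ↪o N) {x : Ser M} (hx : x ≠ 0) :
    (map u x).order = Expo.map u x.order := by
  have h1 : (map u x).coeff (Expo.map u x.order) ≠ 0 := by
    rw [coeff_map]
    exact HahnSeries.coeff_order_eq_zero.not.2 hx
  refine le_antisymm (HahnSeries.order_le_of_coeff_ne_zero h1) ?_
  refine (HahnSeries.le_order_iff_forall ((map_ne_zero _).2 hx)).2 fun g hg => ?_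
  by_contra hg'
  have := (forall_mem_support_map u x (fun g => Expo.map u x.order ≤ g)).2
    (fun g hg => (Expo.map_strictMono u).monotone (HahnSeries.order_le_of_coeff_ne_zero hg))
    g hg'
  exact absurd this (not_le.2 hg)

theorem isSquare_of_order {x : Ser M} {d : Expo M} (hd : x.order = d + d) : IsSquare x := by
  by_cases hx : x = 0
  · exact hx ▸ IsSquare.zero
  have hc : x.coeff (d + d) ≠ 0 := by
    rw [← hd]
    exact HahnSeries.coeff_order_eq_zero.not.2 hx
  obtain ⟨r, hr⟩ := IsAlgClosed.exists_eq_mul_self (x.coeff (d + d))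
  have hr0 : r ≠ 0 := by
    rintro rfl
    simp at hr
    exact hc hr
  let s : Ser M := HahnSeries.single d r
  have hs : s ≠ 0 := HahnSeries.single_ne_zero hr0
  let e : Ser M := x / (s * s) - 1
  have hx' : x = s * s * (1 + e) := by
    simp only [e]
    field_simp
    ring
  have hinv : (s * s) * HahnSeries.single (-(d + d)) (r * r)⁻¹ = 1 := by
    simp only [s, HahnSeries.single_mul_single]
    rw [add_neg_cancel, mul_inv_cancel₀ (mul_ne_zero hr0 hr0), HahnSeries.single_zero_one]
  have he : e = HahnSeries.single (-(d + d)) (r * r)⁻¹ * x - 1 := by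
    simp only [e]
    rw [div_eq_mul_inv, mul_comm x, eq_inv_of_mul_eq_one_right hinv]
  have hepos : ∀ g ∈ e.support, 0 < g := by
    intro g hg
    have hcoeff : e.coeff g = (r * r)⁻¹ * x.coeff (g + (d + d)) - (1 : Ser M).coeff g := by
      rw [he, HahnSeries.coeff_sub]
      congr 1
      have := HahnSeries.coeff_single_mul_add (r := (r * r)⁻¹) (x := x) (a := g + (d + d))
        (b := -(d + d))
      rwa [add_neg_cancel_right] at this
    rcases lt_trichotomy g 0 with h | h | h
    · exfalso
      apply hg
      rw [hcoeff, HahnSeries.coeff_one, if_neg h.ne, HahnSeries.coeff_eq_zero_of_lt_order]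
      · simp
      · rw [hd]
        exact add_lt_of_neg_left _ h
    · exfalso
      apply hg
      rw [hcoeff, HahnSeries.coeff_one, if_pos h, h, zero_add, hr, inv_mul_cancel₀, sub_self]
      exact mul_ne_zero hr0 hr0
    · exact h
  obtain ⟨y, -, hy⟩ := HahnHensel.exists_root (HahnSeries.C (-(1 / 2) : ℂ) * e) (fun g hg => by
      refine hepos g fun h0 => hg ?_
      rw [HahnSeries.C_mul_eq_smul, HahnSeries.coeff_smul, h0, smul_zero])
    (Polynomial.C (HahnSeries.C (1 / 2 : ℂ))) (fun i g hg => by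
      rw [Polynomial.coeff_C] at hg
      split_ifs at hg
      · by_contra hcon
        apply hg
        rw [HahnSeries.C_apply, HahnSeries.coeff_single_of_ne]
        rintro rfl
        exact hcon le_rfl
      · simp at hg)
  refine ⟨s * (1 + y), ?_⟩
  have h2 : (2 : Ser M) * HahnSeries.C (1 / 2 : ℂ) = 1 := by
    rw [← map_ofNat (HahnSeries.C : ℂ →+* Ser M), ← map_mul]
    norm_num
  rw [map_neg, Polynomial.eval_C] at hy
  generalize (HahnSeries.C (1 / 2 : ℂ) : Ser M) = k at h2 hy
  rw [hx']
  clear_value e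
  linear_combination (-2 * s * s) * hy + (s * s * (y ^ 2 - e)) * h2

end Ser

open Polynomial in
theorem Polynomial.exists_map_eq_of_coeff_mem_range {R S : Type*} [Ring R] [Ring S] (f : R →+* S)
    (p : S[X]) (h : ∀ i, p.coeff i ∈ Set.range f) : ∃ q : R[X], q.map f = p :=
  (Polynomial.lifts_iff_coeff_lifts p).2 h

/-- The Hahn series only involving the indices in a finite set. -/
noncomputable def finSer (F : Finset Idx) : Subfield (Ser Idx) :=
  (Ser.map (OrderEmbedding.subtype (· ∈ F))).fieldRange

/-- A refinement of an embedding along an inclusion of ranges. -/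
theorem OrderEmbedding.exists_factor {M N N' : Type} [LinearOrder M] [LinearOrder N]
    [LinearOrder N'] (u : M ↪o N') (v : N ↪o N') (h : ∀ i, u i ∈ Set.range v) :
    ∃ e : M ↪o N, ∀ i, v (e i) = u i := by
  choose e he using h
  exact ⟨OrderEmbedding.ofMapLEIff e fun a b => by rw [← v.le_iff_le, he, he, u.le_iff_le], he⟩

theorem map_mem_finSer {M : Type} [LinearOrder M] (u : M ↪o Idx) {F : Finset Idx}
    (h : ∀ i, u i ∈ F) (x : Ser M) : Ser.map u x ∈ finSer F := by
  obtain ⟨e, he⟩ := OrderEmbedding.exists_factor u (OrderEmbedding.subtype (· ∈ F))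
    fun i => ⟨⟨u i, h i⟩, rfl⟩
  exact ⟨Ser.map e x, Ser.map_map _ _ _ he x⟩

theorem finSer_mono {F G : Finset Idx} (h : F ⊆ G) : finSer F ≤ finSer G := by
  rintro _ ⟨x, rfl⟩
  exact map_mem_finSer _ (fun i => h i.2) x

/-- The union of the fields of Hahn series involving only finitely many indices. -/
noncomputable def bigField : Subfield (Ser Idx) where
  carrier := {x | ∃ F, x ∈ finSer F}
  mul_mem' := by
    rintro x y ⟨F, hx⟩ ⟨G, hy⟩
    exact ⟨F ∪ G, mul_mem (finSer_mono Finset.subset_union_left hx)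
      (finSer_mono Finset.subset_union_right hy)⟩
  add_mem' := by
    rintro x y ⟨F, hx⟩ ⟨G, hy⟩
    exact ⟨F ∪ G, add_mem (finSer_mono Finset.subset_union_left hx)
      (finSer_mono Finset.subset_union_right hy)⟩
  one_mem' := ⟨∅, one_mem _⟩
  zero_mem' := ⟨∅, zero_mem _⟩
  neg_mem' := by
    rintro x ⟨F, hx⟩
    exact ⟨F, neg_mem hx⟩
  inv_mem' := by
    rintro x ⟨F, hx⟩
    exact ⟨F, inv_mem hx⟩

/-- The field of the counterexample. -/
abbrev KK : Type := bigField

namespace KK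

/-- The embedding of a field of Hahn series given by a finite set of indices. -/
noncomputable def emb {M : Type} [LinearOrder M] [Finite M] (u : M ↪o Idx) : Ser M →+* KK :=
  (Ser.map u).codRestrict bigField fun x =>
    ⟨(Set.finite_range u).toFinset, map_mem_finSer u (fun i => by simp) x⟩

section emb

variable {M N : Type} [LinearOrder M] [LinearOrder N] [Finite M] [Finite N]

@[simp] theorem coe_emb (u : M ↪o Idx) (x : Ser M) : (emb u x : Ser Idx) = Ser.map u x := rfl

theorem emb_map (v : N ↪o Idx) (e : M ↪o N) (u : M ↪o Idx) (h : ∀ i, v (e i) = u i) (x : Ser M) :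
    emb v (Ser.map e x) = emb u x :=
  Subtype.ext (Ser.map_map v e u h x)

end emb

/-- The embedding of the field of Hahn series with indices in a finite set. -/
noncomputable abbrev embFin (F : Finset Idx) : Ser {i // i ∈ F} →+* KK :=
  emb (OrderEmbedding.subtype (· ∈ F))

theorem mem_range_embFin_of_coe_mem {x : KK} {F : Finset Idx} (h : (x : Ser Idx) ∈ finSer F) :
    x ∈ Set.range (embFin F) := by
  obtain ⟨y, hy⟩ := h
  exact ⟨y, Subtype.ext hy⟩

theorem exists_embFin_superset (x : KK) (G : Finset Idx) :
    ∃ F, G ⊆ F ∧ x ∈ Set.range (embFin F) := by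
  classical
  obtain ⟨F, hF⟩ := x.2
  exact ⟨F ∪ G, Finset.subset_union_right,
    mem_range_embFin_of_coe_mem (finSer_mono Finset.subset_union_left hF)⟩

theorem exists_embFin (x : KK) : ∃ F, x ∈ Set.range (embFin F) := by
  obtain ⟨F, -, hF⟩ := exists_embFin_superset x ∅
  exact ⟨F, hF⟩

theorem exists_embFin_poly (x : KK) (p : Polynomial KK) :
    ∃ F, x ∈ Set.range (embFin F) ∧ ∀ i, p.coeff i ∈ Set.range (embFin F) := by
  classical
  obtain ⟨F, hF⟩ := x.2
  choose G hG using fun i => (p.coeff i).2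
  have hsub : ∀ i ∈ p.support, G i ⊆ F ∪ p.support.biUnion G := fun i hi =>
    (Finset.subset_biUnion_of_mem G hi).trans Finset.subset_union_right
  refine ⟨F ∪ p.support.biUnion G,
    mem_range_embFin_of_coe_mem (finSer_mono Finset.subset_union_left hF), fun i => ?_⟩
  by_cases hi : i ∈ p.support
  · exact mem_range_embFin_of_coe_mem (finSer_mono (hsub i hi) (hG i))
  · rw [Polynomial.notMem_support_iff.1 hi]
    exact ⟨0, map_zero _⟩

/-- The valuation of an element (with junk value `0` at `0`). -/
noncomputable def v (x : KK) : Expo Idx := (x : Ser Idx).order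

theorem coe_ne_zero {x : KK} (hx : x ≠ 0) : (x : Ser Idx) ≠ 0 :=
  fun h => hx (Subtype.ext h)

theorem v_mul {x y : KK} (hx : x ≠ 0) (hy : y ≠ 0) : v (x * y) = v x + v y :=
  HahnSeries.order_mul (coe_ne_zero hx) (coe_ne_zero hy)

@[simp] theorem v_one : v 1 = 0 := HahnSeries.order_one

theorem v_inv {x : KK} (hx : x ≠ 0) : v x⁻¹ = -v x := by
  have := v_mul hx (inv_ne_zero hx)
  rw [mul_inv_cancel₀ hx, v_one] at this
  exact (neg_eq_of_add_eq_zero_right this.symm).symm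

@[simp] theorem v_neg (x : KK) : v (-x) = v x := HahnSeries.order_neg

theorem min_v_le_v_add {x y : KK} (h : x + y ≠ 0) : min (v x) (v y) ≤ v (x + y) :=
  HahnSeries.min_order_le_order_add (coe_ne_zero h)

theorem exists_v_eq (g : Expo Idx) : ∃ x : KK, x ≠ 0 ∧ v x = g := by
  classical
  let F := (ofLex g).support
  let g' : Expo {i // i ∈ F} := toLex ((ofLex g).comapDomain (Subtype.val) (by simp))
  have hg : Expo.map (OrderEmbedding.subtype (· ∈ F)) g' = g := by
    refine Expo.ext fun i => ?_
    by_cases hi : i ∈ F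
    · exact Expo.map_at' (OrderEmbedding.subtype (· ∈ F)) g' ⟨i, hi⟩
    · rw [Expo.map_at'_of_notMem]
      · exact (Finsupp.notMem_support_iff.1 hi).symm
      · rintro ⟨⟨j, hj⟩, rfl⟩
        exact hi hj
  refine ⟨embFin F (HahnSeries.single g' 1), ?_, ?_⟩
  · exact (map_ne_zero _).2 (HahnSeries.single_ne_zero one_ne_zero)
  · rw [v, coe_emb, Ser.map_single, HahnSeries.order_single one_ne_zero, hg]

theorem isSquare_iff {x : KK} (hx : x ≠ 0) : IsSquare x ↔ ∃ d, v x = d + d := by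
  constructor
  · rintro ⟨y, rfl⟩
    have hy : y ≠ 0 := fun h => hx (by simp [h])
    exact ⟨v y, v_mul hy hy⟩
  · rintro ⟨d, hd⟩
    obtain ⟨F, x, rfl⟩ := exists_embFin x
    have hx' : x ≠ 0 := fun h => hx (by simp [h])
    rw [v, coe_emb, Ser.order_map _ hx'] at hd
    obtain ⟨d', hd'⟩ := Expo.exists_half (g := x.order) fun i => ⟨d.at' i, by
      rw [← Expo.map_at' (OrderEmbedding.subtype (· ∈ F)), hd]; rfl⟩
    exact (Ser.isSquare_of_order hd').map (embFin F)

/-- The elements of the form `0` or with positive valuation. -/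
def IsPos (x : KK) : Prop := x ≠ 0 → 0 < v x

/-- The elements of the form `0` or with nonnegative valuation. -/
def IsNonneg (x : KK) : Prop := x ≠ 0 → 0 ≤ v x

theorem isPos_iff {x : KK} : IsPos x ↔ ∀ g ∈ (x : Ser Idx).support, 0 < g := by
  constructor
  · intro h g hg
    refine (h ?_).trans_le (HahnSeries.order_le_of_coeff_ne_zero hg)
    rintro rfl
    simp at hg
  · intro h hx
    exact h _ (HahnSeries.coeff_order_eq_zero.not.2 (coe_ne_zero hx))

theorem isNonneg_iff {x : KK} : IsNonneg x ↔ ∀ g ∈ (x : Ser Idx).support, 0 ≤ g := by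
  constructor
  · intro h g hg
    refine (h ?_).trans (HahnSeries.order_le_of_coeff_ne_zero hg)
    rintro rfl
    simp at hg
  · intro h hx
    exact h _ (HahnSeries.coeff_order_eq_zero.not.2 (coe_ne_zero hx))

theorem exists_root {w : KK} (hw : IsPos w) {G : Polynomial KK} (hG : ∀ i, IsNonneg (G.coeff i)) :
    ∃ y : KK, IsPos y ∧ w + y + y ^ 2 * G.eval y = 0 := by
  obtain ⟨F, ⟨w, rfl⟩, hF⟩ := exists_embFin_poly w G
  obtain ⟨G, rfl⟩ := Polynomial.exists_map_eq_of_coeff_mem_range _ G hF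
  rw [isPos_iff, coe_emb, Ser.pos_map_iff] at hw
  simp only [Polynomial.coeff_map, isNonneg_iff, coe_emb, Ser.nonneg_map_iff] at hG
  obtain ⟨y, hy, hy'⟩ := HahnHensel.exists_root w hw G hG
  refine ⟨embFin F y, ?_, ?_⟩
  · rwa [isPos_iff, coe_emb, Ser.pos_map_iff]
  · rw [Polynomial.eval_map_apply, ← map_pow, ← map_mul, ← map_add, ← map_add, hy', map_zero]

end KK

namespace Expo

/-- The exponents that are nonnegative or vanish up to an index. -/
def prefixCone (j : Idx) : AddSubmonoid (Expo Idx) where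
  carrier := {g | ∀ i ≤ j, (∀ k < i, g.at' k = 0) → 0 ≤ g.at' i}
  zero_mem' := fun _ _ _ => le_rfl
  add_mem' := by
    intro g h hg hh i hi h0
    have h1 : ∀ k < i, g.at' k = 0 ∧ h.at' k = 0 := by
      intro k
      induction k using WellFoundedLT.induction with
      | ind k ih =>
        intro hk
        have hg' := hg k (hk.le.trans hi) fun l hl => (ih l hl (hl.trans hk)).1
        have hh' := hh k (hk.le.trans hi) fun l hl => (ih l hl (hl.trans hk)).2
        have := h0 k hk
        rw [at'_add] at this
        omega
    exact add_nonneg (hg i hi fun k hk => (h1 k hk).1) (hh i hi fun k hk => (h1 k hk).2)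

theorem prefixCone_of_nonneg {j : Idx} {g : Expo Idx} (hg : 0 ≤ g) : g ∈ prefixCone j := by
  intro i _ h0
  by_contra hcon
  have : g < 0 := lt_iff.2 ⟨i, h0, not_le.1 hcon⟩
  exact absurd this (not_lt.2 hg)

theorem prefixCone_of_le {j : Idx} {g h : Expo Idx} (hg : g ∈ prefixCone j) (hgh : g ≤ h) :
    h ∈ prefixCone j := by
  rw [← sub_add_cancel h g]
  exact add_mem (prefixCone_of_nonneg (sub_nonneg.2 hgh)) hg

theorem prefixCone_antitone : Antitone prefixCone := fun _ _ hij _ hg k hk => hg k (hk.trans hij)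

theorem single_mem_prefixCone {i j : Idx} {n : ℤ} (hn : n < 0) :
    single i n ∈ prefixCone j ↔ j < i := by
  constructor
  · intro h
    by_contra hcon
    have := h i (not_lt.1 hcon) fun k hk => at'_single_of_ne hk.ne' n
    rw [at'_single_self] at this
    omega
  · intro h k hk _
    rw [at'_single_of_ne (hk.trans_lt h).ne']

end Expo

namespace KK

/-- The valuation ring attached to the cone `Expo.prefixCone j`. -/
noncomputable def ring (j : Idx) : ValuationSubring KK where
  carrier := {x | x ≠ 0 → v x ∈ Expo.prefixCone j}
  mul_mem' := by
    intro x y hx hy hxy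
    rw [v_mul (left_ne_zero_of_mul hxy) (right_ne_zero_of_mul hxy)]
    exact add_mem (hx (left_ne_zero_of_mul hxy)) (hy (right_ne_zero_of_mul hxy))
  one_mem' _ := by simp
  add_mem' := by
    intro x y hx hy hxy
    by_cases hx0 : x = 0
    · subst hx0
      rw [zero_add] at hxy ⊢
      exact hy hxy
    by_cases hy0 : y = 0
    · subst hy0
      rw [add_zero] at hxy ⊢
      exact hx hxy
    refine Expo.prefixCone_of_le ?_ (min_v_le_v_add hxy)
    rcases min_choice (v x) (v y) with h | h
    · rw [h]; exact hx hx0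
    · rw [h]; exact hy hy0
  zero_mem' h := absurd rfl h
  neg_mem' := by
    intro x hx h
    rw [v_neg]
    exact hx (neg_ne_zero.1 h)
  mem_or_inv_mem' := by
    intro x
    by_cases hx : x = 0
    · exact Or.inl fun h => absurd hx h
    rcases le_total 0 (v x) with h | h
    · exact Or.inl fun _ => Expo.prefixCone_of_nonneg h
    · refine Or.inr fun _ => Expo.prefixCone_of_nonneg ?_
      rw [v_inv hx]
      exact neg_nonneg.2 h

theorem mem_ring {j : Idx} {x : KK} : x ∈ ring j ↔ (x ≠ 0 → v x ∈ Expo.prefixCone j) := Iff.rfl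

theorem isNonneg_of_mem_maximalIdeal {j : Idx} {x : ring j}
    (hx : x ∈ IsLocalRing.maximalIdeal (ring j)) : IsNonneg (x : KK) := by
  intro hx0
  by_contra hcon
  rw [IsLocalRing.mem_maximalIdeal, mem_nonunits_iff] at hx
  apply hx
  have hinv : (x : KK)⁻¹ ∈ ring j := fun _ => by
    rw [v_inv hx0]
    exact Expo.prefixCone_of_nonneg (neg_nonneg.2 (not_le.1 hcon).le)
  exact IsUnit.of_mul_eq_one ⟨_, hinv⟩ (Subtype.ext (mul_inv_cancel₀ hx0))

theorem isPos_mem_ring {j : Idx} {x : KK} (hx : IsPos x) : x ∈ ring j :=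
  fun h => Expo.prefixCone_of_nonneg (hx h).le

open Polynomial in
theorem henselian_ring {i j : Idx} (hij : j < i) : HenselianLocalRing (ring j) where
  is_henselian f _ a₀ he hd := by
    obtain ⟨t, ht0, ht⟩ := exists_v_eq (Expo.single i 1)
    have htpos : IsPos t := fun _ => by
      rw [ht]
      exact Expo.lt_iff.2 ⟨i, fun k hk => (Expo.at'_single_of_ne hk.ne' 1).symm, by simp⟩
    have htinv : t⁻¹ ∈ ring j := fun _ => by
      rw [v_inv ht0, ht, show -Expo.single i 1 = Expo.single i (-1) from
        Expo.ext fun k => by simp [Expo.single, Expo.at'] ]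
      exact (Expo.single_mem_prefixCone (by norm_num)).2 hij
    let t' : ring j := ⟨t, isPos_mem_ring htpos⟩
    let s' : ring j := ⟨t⁻¹, htinv⟩
    have hts : t' * s' = 1 := Subtype.ext (mul_inv_cancel₀ ht0)
    obtain ⟨b, hb⟩ := hd.exists_right_inv
    let p := taylor a₀ f
    let h := divX (divX p)
    have hp : ∀ y, f.eval (y + a₀) = f.eval a₀ + y * (f.derivative.eval a₀ + y * h.eval y) := by
      intro y
      have h1 : p = C (p.coeff 0) + X * (C (p.coeff 1) + X * h) := by
        conv_lhs => rw [← X_mul_divX_add p, ← X_mul_divX_add p.divX, coeff_divX]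
        ring
      rw [← taylor_eval]
      change p.eval y = _
      rw [h1, taylor_coeff_zero, taylor_coeff_one]
      simp
    let c := f.eval a₀ * b * s'
    have hc : c ∈ IsLocalRing.maximalIdeal (ring j) :=
      Ideal.mul_mem_right _ _ (Ideal.mul_mem_right _ _ he)
    let G : (ring j)[X] := C (c * b) * h.comp (C c * X)
    obtain ⟨y, hy, hy0⟩ := exists_root htpos (G := G.map (ring j).subtype) fun k => by
      rw [coeff_map]
      apply isNonneg_of_mem_maximalIdeal (j := j)
      rw [coeff_C_mul]
      exact Ideal.mul_mem_right _ _ (Ideal.mul_mem_right _ _ hc)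
    let y' : ring j := ⟨y, isPos_mem_ring hy⟩
    have hy1 : t' + y' + y' ^ 2 * G.eval y' = 0 := by
      refine Subtype.ext ?_
      have h2 : (G.map (ring j).subtype).eval y = ((G.eval y' : ring j) : KK) :=
        eval_map_apply (f := (ring j).subtype) y'
      rw [h2] at hy0
      exact hy0
    have hG : G.eval y' = c * b * h.eval (c * y') := by simp [G]
    refine ⟨c * y' + a₀, ?_, ?_⟩
    · rw [IsRoot.def, hp]
      rw [hG] at hy1
      generalize h.eval (c * y') = q at hy1 ⊢
      have hcdef : c = f.eval a₀ * b * s' := rfl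
      generalize c = c at hy1 hcdef ⊢
      linear_combination (f.derivative.eval a₀ * c) * hy1 -
        (c ^ 2 * y' ^ 2 * q + f.eval a₀ * t' * s') * hb - f.eval a₀ * hts -
        f.derivative.eval a₀ * t' * hcdef
    · rw [add_sub_cancel_right]
      exact Ideal.mul_mem_right _ _ hc

end KK

/-- An injective ring homomorphism as an embedding in the language of rings. -/
def RingHom.toRingEmbedding {R S : Type*} [Ring R] [Ring S] [Ring.CompatibleRing R]
    [Ring.CompatibleRing S] (f : R →+* S) (hf : Function.Injective f) :
    Language.ring.Embedding R S where
  toFun := f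
  inj' := hf
  map_fun' := fun {n} g => by cases g <;> simp
  map_rel' := fun {n} g => by cases g

noncomputable instance KK.compatibleRing : Ring.CompatibleRing KK := Ring.compatibleRingOfRing KK

noncomputable instance Ser.compatibleRing (M : Type) [LinearOrder M] :
    Ring.CompatibleRing (Ser M) := Ring.compatibleRingOfRing (Ser M)

namespace KK

theorem realize_emb_of_isQF {α : Type*} {n : ℕ} {φ : Language.ring.BoundedFormula α n}
    (hφ : φ.IsQF) {M : Type} [LinearOrder M] [Finite M] (u : M ↪o Idx) (z : α → Ser M)
    (xs : Fin n → Ser M) : φ.Realize (emb u ∘ z) (emb u ∘ xs) ↔ φ.Realize z xs :=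
  hφ.realize_embedding ((emb u).toRingEmbedding (emb u).injective)

/-- Formulas of a given quantifier complexity do not distinguish matched index sets. -/
def Indist (k : ℕ) : Prop :=
  ∀ {α : Type} {b : Bool} {n : ℕ} {φ : Language.ring.BoundedFormula α n}, IsQN b k φ →
    ∀ {M : Type} [LinearOrder M] [Finite M] {u v : M ↪o Idx}, Idx.Matched k u v →
    ∀ (z : α → Ser M) (xs : Fin n → Ser M),
      φ.Realize (emb u ∘ z) (emb u ∘ xs) ↔ φ.Realize (emb v ∘ z) (emb v ∘ xs)

/-- The formula has truth value `b` in some finite extension of `u`, robustly under matching. -/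
def Forced {α : Type} (k : ℕ) (b : Bool) {n : ℕ} (φ : Language.ring.BoundedFormula α n)
    {M : Type} [LinearOrder M] (u : M ↪o Idx) (z : α → Ser M) (xs : Fin n → Ser M) : Prop :=
  ∃ (M' : Type) (_ : LinearOrder M') (_ : Finite M') (e : M ↪o M') (u' : M' ↪o Idx),
    (∀ i, u' (e i) = u i) ∧ ∀ v' : M' ↪o Idx, Idx.Matched k u' v' →
      (φ.Realize (emb v' ∘ Ser.map e ∘ z) (emb v' ∘ Ser.map e ∘ xs) ↔ b = true)

theorem emb_comp_map {α M N : Type} [LinearOrder M] [LinearOrder N] [Finite M] [Finite N]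
    (v : N ↪o Idx) (e : M ↪o N) (u : M ↪o Idx) (h : ∀ i, v (e i) = u i) (z : α → Ser M) :
    emb v ∘ Ser.map e ∘ z = emb u ∘ z :=
  funext fun i => emb_map v e u h (z i)

theorem exists_witness {M : Type} [LinearOrder M] [Finite M] (u : M ↪o Idx) (x : KK) :
    ∃ (N : Type) (_ : LinearOrder N) (_ : Finite N) (e : M ↪o N) (w : N ↪o Idx)
      (y : Ser N), (∀ i, w (e i) = u i) ∧ emb w y = x := by
  obtain ⟨F, hF, y, hy⟩ := exists_embFin_superset x (Set.finite_range u).toFinset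
  obtain ⟨e, he⟩ := OrderEmbedding.exists_factor u (OrderEmbedding.subtype (· ∈ F))
    fun i => ⟨⟨u i, hF (by simp)⟩, rfl⟩
  exact ⟨{i // i ∈ F}, inferInstance, inferInstance, e, OrderEmbedding.subtype (· ∈ F), y, he, hy⟩

theorem Forced.of_snoc {α : Type} {k : ℕ} {b : Bool} {n : ℕ}
    {φ : Language.ring.BoundedFormula α (n + 1)} {ψ : Language.ring.BoundedFormula α n}
    (hψ : ∀ (z : α → KK) (xs : Fin n → KK) (y : KK),
      (φ.Realize z (Fin.snoc xs y) ↔ b = true) → (ψ.Realize z xs ↔ b = true))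
    {M N : Type} [LinearOrder M] [LinearOrder N] {u : M ↪o Idx} {w : N ↪o Idx} {e : M ↪o N}
    (he : ∀ i, w (e i) = u i) {z : α → Ser M} {xs : Fin n → Ser M} {y : Ser N}
    (h : Forced k b φ w (Ser.map e ∘ z) (Fin.snoc (Ser.map e ∘ xs) y)) :
    Forced k b ψ u z xs := by
  obtain ⟨M', _, _, e', u', hu', H⟩ := h
  refine ⟨M', inferInstance, inferInstance, e.trans e', u', fun i => (hu' (e i)).trans (he i),
    fun v' hv' => hψ _ _ (emb v' (Ser.map e' y)) ?_⟩
  have h1 := H v' hv'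
  rw [Fin.comp_snoc, Fin.comp_snoc] at h1
  have h2 : ∀ {β : Type} (z : β → Ser M), Ser.map e' ∘ Ser.map e ∘ z = Ser.map (e.trans e') ∘ z :=
    fun z => funext fun i => Ser.map_map e' e (e.trans e') (fun _ => rfl) (z i)
  rwa [h2, h2] at h1

theorem forced_of_realize {k : ℕ} (hk : Indist k) {α : Type} {b : Bool} {m n : ℕ}
    {φ : Language.ring.BoundedFormula α n} (hφ : IsQN b m φ) (hm : m = k + 1)
    {M : Type} [LinearOrder M] [Finite M] (u : M ↪o Idx) (z : α → Ser M) (xs : Fin n → Ser M)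
    (h : φ.Realize (emb u ∘ z) (emb u ∘ xs) ↔ b = true) : Forced k b φ u z xs := by
  induction hφ generalizing M with
  | of_isQF hφ =>
    refine ⟨M, inferInstance, inferInstance, RelEmbedding.refl _, u, fun _ => rfl, fun v' _ => ?_⟩
    rw [emb_comp_map v' _ v' fun _ => rfl, emb_comp_map v' _ v' fun _ => rfl,
      realize_emb_of_isQF hφ]
    rwa [realize_emb_of_isQF hφ] at h
  | of_flip hφ _ =>
    obtain rfl := Nat.succ.inj hm
    refine ⟨M, inferInstance, inferInstance, RelEmbedding.refl _, u, fun _ => rfl, fun v' hv' => ?_⟩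
    rw [emb_comp_map v' _ v' fun _ => rfl, emb_comp_map v' _ v' fun _ => rfl, ← hk hφ hv']
    exact h
  | ex hφ ih =>
    obtain ⟨x, hx⟩ := BoundedFormula.realize_ex.1 (h.2 rfl)
    obtain ⟨N, _, _, e, w, y, he, rfl⟩ := exists_witness u x
    refine Forced.of_snoc (fun z xs y hy => ?_) he (ih hm w _ (Fin.snoc (Ser.map e ∘ xs) y) ?_)
    · exact iff_of_true (BoundedFormula.realize_ex.2 ⟨y, hy.2 rfl⟩) rfl
    · rw [Fin.comp_snoc, emb_comp_map w e u he, emb_comp_map w e u he]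
      exact iff_of_true hx rfl
  | all hφ ih =>
    have h1 := h.not.2 (by simp)
    rw [BoundedFormula.realize_all] at h1
    push Not at h1
    obtain ⟨x, hx⟩ := h1
    obtain ⟨N, _, _, e, w, y, he, rfl⟩ := exists_witness u x
    refine Forced.of_snoc (fun z xs y hy => ?_) he (ih hm w _ (Fin.snoc (Ser.map e ∘ xs) y) ?_)
    · refine iff_of_false (fun hall => ?_) (by simp)
      exact absurd (hy.1 (BoundedFormula.realize_all.1 hall y)) (by simp)
    · rw [Fin.comp_snoc, emb_comp_map w e u he, emb_comp_map w e u he]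
      exact iff_of_false hx (by simp)

theorem indist (k : ℕ) : Indist k := by
  induction k with
  | zero =>
    intro α b n φ hφ M _ _ u v _ z xs
    cases hφ with
    | of_isQF hφ => rw [realize_emb_of_isQF hφ, realize_emb_of_isQF hφ]
  | succ k ih =>
    intro α b n φ hφ M _ _ u v huv z xs
    have key : ∀ {u v : M ↪o Idx}, Idx.Matched (k + 1) u v →
        (φ.Realize (emb u ∘ z) (emb u ∘ xs) ↔ b = true) →
        (φ.Realize (emb v ∘ z) (emb v ∘ xs) ↔ b = true) := by
      intro u v huv h
      obtain ⟨M', _, _, e, u', hu', H⟩ := forced_of_realize ih hφ rfl u z xs h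
      obtain ⟨v', hv', hm⟩ := huv.exists_extend e u' hu'
      have := H v' hm
      rwa [emb_comp_map v' e v hv', emb_comp_map v' e v hv'] at this
    have h1 := key huv
    have h2 := key huv.symm
    tauto

theorem not_definable {b : Bool} {φ : Language.ring.Formula (Fin 1)} (hφ : IsQN b 3 φ) :
    ¬ ∀ x : KK, x ∈ ring (Idx.threePow 1) ↔ φ.Realize fun _ => x := by
  intro H
  let s : Ser Unit := HahnSeries.single (Expo.single () (-1)) 1
  have hs : ∀ i, emb (Idx.point i) s ∈ ring (Idx.threePow 1) ↔ Idx.threePow 1 < i := by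
    intro i
    have h0 : emb (Idx.point i) s ≠ 0 :=
      (map_ne_zero _).2 (HahnSeries.single_ne_zero one_ne_zero)
    have hv : v (emb (Idx.point i) s) = Expo.single i (-1) := by
      rw [v, coe_emb, Ser.map_single, HahnSeries.order_single one_ne_zero, Expo.map_single]
      rfl
    rw [mem_ring, hv]
    simp only [h0, ne_eq, not_false_eq_true, true_imp_iff]
    exact Expo.single_mem_prefixCone (by norm_num)
  have h1 := indist 3 hφ Idx.matched_threePow (fun _ => s) default
  have h2 := (H (emb (Idx.point (Idx.threePow 1)) s)).symm
  have h3 := (H (emb (Idx.point (Idx.threePow 2)) s)).symm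
  rw [hs] at h2 h3
  have h4 : ∀ x : KK, ∀ xs : Fin 0 → KK,
      (BoundedFormula.Realize φ (fun _ => x) xs ↔ φ.Realize fun _ => x) := by
    intro x xs
    rw [Formula.Realize, Subsingleton.elim xs default]
  have h5 := h2.symm.trans (((h4 _ _).symm.trans (h1.trans (h4 _ _))).trans h3)
  exact lt_irrefl _ (h5.2 (Idx.threePow_strictMono (by norm_num)))

end KK

namespace Expo

theorem exists_reduce {M : Type} [LinearOrder M] (g : Expo M) :
    ∃ d : Expo M, ∀ i, (g + (d + d)).at' i = g.at' i % 2 := by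
  refine ⟨toLex ((ofLex g).mapRange (fun n : ℤ => -(n / 2)) (by simp)), fun i => ?_⟩
  rw [at'_add, at'_add]
  change g.at' i + (-(g.at' i / 2) + -(g.at' i / 2)) = g.at' i % 2
  omega

/-- The first odd coordinate of the exponent is at the given index. -/
def OddAt {M : Type} [LinearOrder M] (g : Expo M) (j : M) : Prop :=
  Odd (g.at' j) ∧ ∀ i < j, Even (g.at' i)

theorem OddAt.add_double {M : Type} [LinearOrder M] {g : Expo M} {j : M} (h : g.OddAt j)
    (d : Expo M) : (g + (d + d)).OddAt j :=
  ⟨h.1.add_even ⟨_, rfl⟩, fun i hi => (h.2 i hi).add ⟨_, rfl⟩⟩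

theorem OddAt.ne_double {M : Type} [LinearOrder M] {g : Expo M} {j : M} (h : g.OddAt j) (d : Expo M) :
    g ≠ d + d := by
  rintro rfl
  exact Int.not_even_iff_odd.2 h.1 ⟨_, rfl⟩

theorem OddAt.add_pos {b g : Expo Idx} {j : Idx} (h : b.OddAt j) (hb : 0 < b)
    (hg : g ∈ prefixCone j) : 0 < b + (g + g) := by
  rcases le_or_gt 0 g with hg0 | hg0
  · exact add_pos_of_pos_of_nonneg hb (add_nonneg hg0 hg0)
  obtain ⟨i, hi, hi'⟩ := lt_iff.1 hg0
  obtain ⟨l, hl, hl'⟩ := lt_iff.1 hb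
  simp only [at'_zero] at hi hi' hl hl'
  have hji : j < i := by
    by_contra hcon
    exact absurd (hg i (not_lt.1 hcon) hi) (not_le.2 hi')
  have hlj : l ≤ j := by
    by_contra hcon
    have h1 := h.1
    rw [← hl j (not_le.1 hcon)] at h1
    simp at h1
  refine lt_iff.2 ⟨l, fun k hk => ?_, ?_⟩
  · simp [hi k (hk.trans_le (hlj.trans hji.le)), ← hl k hk]
  · simpa [hi l (hlj.trans_lt hji)] using hl'

theorem mem_prefixCone_of_forall {a g : Expo Idx} {j : Idx} (h : a.OddAt j)
    (H : ∀ d, 0 < a + (d + d) → 0 < a + (d + d) + (g + g)) : g ∈ prefixCone j := by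
  intro i hi h0
  by_contra hcon
  obtain ⟨d, hd⟩ := exists_reduce a
  have hlow : ∀ k < j, (a + (d + d)).at' k = 0 := fun k hk => by
    rw [hd, Int.even_iff.1 (h.2 k hk)]
  have hj : (a + (d + d)).at' j = 1 := by rw [hd, Int.odd_iff.1 h.1]
  have hpos : 0 < a + (d + d) :=
    lt_iff.2 ⟨j, fun k hk => (hlow k hk).symm, by rw [hj]; exact one_pos⟩
  refine absurd (H d hpos) (not_lt.2 (le_of_lt (lt_iff.2 ⟨i, fun k hk => ?_, ?_⟩)))
  · rw [at'_add, hlow k (hk.trans_le hi), at'_add, h0 k hk]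
    rfl
  · rw [at'_add (a + (d + d)) (g + g), at'_add g g, at'_zero]
    rcases hi.lt_or_eq with hij | rfl
    · rw [hlow i hij]; omega
    · rw [hj]; omega

end Expo

namespace KK

/-- The valuation of an element has its first odd coordinate at the given index. -/
def OddAt (t : KK) (j : Idx) : Prop := (v t).OddAt j

theorem OddAt.ne_zero {t : KK} {j : Idx} (h : OddAt t j) : t ≠ 0 := by
  rintro rfl
  refine Expo.OddAt.ne_double h 0 ?_
  rw [v, add_zero]
  exact HahnSeries.order_zero

theorem exists_oddAt (j : Idx) : ∃ t, OddAt t j := by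
  obtain ⟨t, -, ht⟩ := exists_v_eq (Expo.single j 1)
  refine ⟨t, ?_⟩
  rw [OddAt, ht]
  exact ⟨by simp, fun i hi => by simp [Expo.at'_single_of_ne (ne_of_gt hi)]⟩

/-- Nonsquares. -/
def NonSq (t : KK) : Prop := ¬∃ z, z * z = t

theorem isSquare_iff_exists {t : KK} : IsSquare t ↔ ∃ z, z * z = t :=
  exists_congr fun _ => eq_comm

theorem nonSq_iff {t : KK} : NonSq t ↔ ∃ j, OddAt t j := by
  rw [NonSq, ← isSquare_iff_exists]
  constructor
  · intro h
    have ht : t ≠ 0 := by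
      rintro rfl
      exact h IsSquare.zero
    rw [isSquare_iff ht] at h
    have hodd : ∃ j, Odd ((v t).at' j) := by
      by_contra hcon
      push Not at hcon
      exact h (Expo.exists_half fun i => Int.not_odd_iff_even.1 (hcon i))
    obtain ⟨j, hj, hmin⟩ := WellFounded.has_min (wellFounded_lt (α := Idx)) {j | Odd ((v t).at' j)}
      hodd
    exact ⟨j, hj, fun i hi => Int.not_odd_iff_even.1 fun h => hmin i h hi⟩
  · rintro ⟨j, hj⟩ h
    obtain ⟨d, hd⟩ := (isSquare_iff hj.ne_zero).1 h
    exact Expo.OddAt.ne_double hj d hd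

theorem v_add_of_lt {x y : KK} (hx : x ≠ 0) (h : y ≠ 0 → v x < v y) :
    x + y ≠ 0 ∧ v (x + y) = v x := by
  by_cases hy : y = 0
  · subst hy
    simpa using hx
  have hlt := h hy
  have h0 : x + y ≠ 0 := by
    intro h0
    rw [eq_neg_of_add_eq_zero_left h0, v_neg] at hlt
    exact lt_irrefl _ hlt
  refine ⟨h0, le_antisymm ?_ ?_⟩
  · by_contra hcon
    have h1 := min_v_le_v_add (x := x + y) (y := -y) (by simpa using hx)
    rw [v_neg, add_neg_cancel_right] at h1
    exact absurd h1 (not_le.2 (lt_min (not_le.1 hcon) hlt))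
  · have := min_v_le_v_add h0
    rwa [min_eq_left hlt.le] at this

/-- The auxiliary square condition. -/
def SqCond (x t : KK) : Prop := ∃ z, z * z = 1 + t * x * x

theorem sqCond_iff {t : KK} {j : Idx} (ht : OddAt t j) {x : KK} :
    SqCond x t ↔ (x ≠ 0 → 0 < v t + (v x + v x)) := by
  rw [SqCond, ← isSquare_iff_exists]
  by_cases hx : x = 0
  · subst hx
    simp
  simp only [hx, ne_eq, not_false_eq_true, true_imp_iff]
  have ha : v (t * x * x) = v t + (v x + v x) := by
    rw [v_mul (mul_ne_zero ht.ne_zero hx) hx, v_mul ht.ne_zero hx, add_assoc]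
  have ha0 : t * x * x ≠ 0 := mul_ne_zero (mul_ne_zero ht.ne_zero hx) hx
  have hodd : (v (t * x * x)).OddAt j := by
    rw [ha]
    exact Expo.OddAt.add_double ht _
  rw [← ha]
  constructor
  · intro h
    by_contra hcon
    have hlt : v (t * x * x) < 0 :=
      lt_of_le_of_ne (not_lt.1 hcon) fun h0 => hodd.ne_double 0 (by rw [h0, add_zero])
    obtain ⟨h1, h2⟩ := v_add_of_lt (y := 1) ha0 fun _ => by rwa [v_one]
    rw [add_comm] at h
    obtain ⟨d, hd⟩ := (isSquare_iff h1).1 h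
    rw [h2] at hd
    exact hodd.ne_double d hd
  · intro h
    obtain ⟨h1, h2⟩ := v_add_of_lt (x := 1) one_ne_zero (y := t * x * x) fun _ => by rwa [v_one]
    exact (isSquare_iff h1).2 ⟨0, by rw [h2, v_one, add_zero]⟩

/-- The stabilizer condition describing the valuation ring attached to `t`. -/
def Stab (t y : KK) : Prop := ∀ x, SqCond x t → SqCond (x * y) t

theorem stab_iff {t : KK} {j : Idx} (ht : OddAt t j) {y : KK} : Stab t y ↔ y ∈ ring j := by
  rw [mem_ring]
  constructor
  · intro h hy
    refine Expo.mem_prefixCone_of_forall ht fun d hd => ?_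
    obtain ⟨x, hx, rfl⟩ := exists_v_eq d
    have := (sqCond_iff ht).1 (h x ((sqCond_iff ht).2 fun _ => hd)) (mul_ne_zero hx hy)
    rw [v_mul hx hy] at this
    convert this using 1
    abel
  · intro h x hx
    refine (sqCond_iff ht).2 fun hxy => ?_
    have hx0 := left_ne_zero_of_mul hxy
    have hy0 := right_ne_zero_of_mul hxy
    have := (Expo.OddAt.add_double ht (v x)).add_pos ((sqCond_iff ht).1 hx hx0) (h hy0)
    rw [v_mul hx0 hy0]
    convert this using 1
    abel

/-- Comparison of the attached valuation rings. -/
def Lt (t s : KK) : Prop := ∃ y, Stab t y ∧ ¬Stab s y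

theorem lt_iff {t s : KK} {i j : Idx} (ht : OddAt t i) (hs : OddAt s j) : Lt t s ↔ i < j := by
  simp only [Lt, stab_iff ht, stab_iff hs]
  constructor
  · rintro ⟨y, h1, h2⟩
    by_contra hcon
    exact h2 fun hy => Expo.prefixCone_antitone (not_lt.1 hcon) (h1 hy)
  · intro hij
    obtain ⟨y, hy, hv⟩ := exists_v_eq (Expo.single j (-1))
    refine ⟨y, fun _ => ?_, fun h => ?_⟩
    · rw [hv]
      exact (Expo.single_mem_prefixCone (by norm_num)).2 hij
    · have := h hy
      rw [hv, Expo.single_mem_prefixCone (by norm_num)] at this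
      exact lt_irrefl _ this

/-- The index attached to `t` is a limit of order `n`. -/
def Lim : ℕ → KK → Prop
  | 0, _ => True
  | n + 1, t => ∀ s, NonSq s → Lt s t → ∃ r, NonSq r ∧ Lt s r ∧ Lt r t ∧ Lim n r

theorem lim_iff {n : ℕ} {t : KK} {j : Idx} (ht : OddAt t j) : Lim n t ↔ Idx.IsLim n j := by
  induction n generalizing t j with
  | zero => exact Iff.rfl
  | succ n ih =>
    constructor
    · intro h i hi
      obtain ⟨s, hs⟩ := exists_oddAt i
      obtain ⟨r, hr, hsr, hrt, hl⟩ := h s (nonSq_iff.2 ⟨i, hs⟩) ((lt_iff hs ht).2 hi)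
      obtain ⟨k, hk⟩ := nonSq_iff.1 hr
      exact ⟨k, (lt_iff hs hk).1 hsr, (lt_iff hk ht).1 hrt, (ih hk).1 hl⟩
    · intro h s hs hst
      obtain ⟨i, hi⟩ := nonSq_iff.1 hs
      obtain ⟨k, hik, hkj, hl⟩ := h i ((lt_iff hi ht).1 hst)
      obtain ⟨r, hr⟩ := exists_oddAt k
      exact ⟨r, nonSq_iff.2 ⟨k, hr⟩, (lt_iff hi hr).2 hik, (lt_iff hr ht).2 hkj, (ih hr).2 hl⟩

theorem mem_ring_iff {y : KK} : y ∈ ring (Idx.threePow 1) ↔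
    ∃ t, NonSq t ∧ Lim 3 t ∧ (∃ s, NonSq s ∧ Lt s t) ∧ Stab t y := by
  constructor
  · intro hy
    obtain ⟨t, ht⟩ := exists_oddAt (Idx.threePow 1)
    obtain ⟨s, hs⟩ := exists_oddAt (Idx.threePow 0)
    exact ⟨t, nonSq_iff.2 ⟨_, ht⟩, (lim_iff ht).2 (Idx.isLim_threePow 1),
      ⟨s, nonSq_iff.2 ⟨_, hs⟩, (lt_iff hs ht).2 (Idx.threePow_strictMono one_pos)⟩,
      (stab_iff ht).2 hy⟩
  · rintro ⟨t, ht, hlim, ⟨s, hs, hst⟩, hy⟩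
    obtain ⟨j, ht⟩ := nonSq_iff.1 ht
    obtain ⟨i, hs⟩ := nonSq_iff.1 hs
    have hle := Idx.threePow_one_le ((lim_iff ht).1 hlim) ((lt_iff hs ht).1 hst)
    exact fun hy0 => Expo.prefixCone_antitone hle ((stab_iff ht).1 hy hy0)

/-- Parameter-free definability of a predicate on assignments. -/
def IsDef {α : Type} (P : (α → KK) → Prop) : Prop :=
  ∃ φ : Language.ring.Formula α, ∀ z, φ.Realize z ↔ P z

namespace IsDef

variable {α : Type} {P Q : (α → KK) → Prop}

theorem not (hP : IsDef P) : IsDef fun z => ¬P z := by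
  obtain ⟨φ, hφ⟩ := hP
  exact ⟨∼φ, fun z => by rw [Formula.realize_not, hφ]⟩

theorem and (hP : IsDef P) (hQ : IsDef Q) : IsDef fun z => P z ∧ Q z := by
  obtain ⟨φ, hφ⟩ := hP
  obtain ⟨ψ, hψ⟩ := hQ
  exact ⟨φ ⊓ ψ, fun z => by rw [Formula.realize_inf, hφ, hψ]⟩

theorem imp (hP : IsDef P) (hQ : IsDef Q) : IsDef fun z => P z → Q z := by
  obtain ⟨φ, hφ⟩ := hP
  obtain ⟨ψ, hψ⟩ := hQ
  exact ⟨φ.imp ψ, fun z => by rw [Formula.realize_imp, hφ, hψ]⟩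

theorem ex {R : (α → KK) → KK → Prop}
    (hR : IsDef fun z : Option α → KK => R (fun i => z (some i)) (z none)) :
    IsDef fun z => ∃ x, R z x := by
  obtain ⟨φ, hφ⟩ := hR
  let f : Option α → α ⊕ Unit := fun o => o.elim (Sum.inr ()) Sum.inl
  refine ⟨(φ.relabel f).iExs Unit, fun z => ?_⟩
  rw [Formula.realize_iExs]
  simp only [Formula.realize_relabel, hφ]
  exact ⟨fun ⟨i, hi⟩ => ⟨i (), hi⟩, fun ⟨x, hx⟩ => ⟨fun _ => x, hx⟩⟩

theorem all {R : (α → KK) → KK → Prop}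
    (hR : IsDef fun z : Option α → KK => R (fun i => z (some i)) (z none)) :
    IsDef fun z => ∀ x, R z x := by
  have := (ex (R := fun z x => ¬R z x) hR.not).not
  simpa only [not_exists, not_not] using this

theorem nonSq (i : α) : IsDef fun z => NonSq (z i) := by
  refine (ex ?_).not
  exact ⟨((Term.var none * Term.var none : Language.ring.Term (Option α))).equal
    (Term.var (some i)), fun z => by simp [Formula.realize_equal]⟩

theorem sqCond (i j : α) : IsDef fun z => SqCond (z i) (z j) := by
  refine ex ?_
  exact ⟨((Term.var none * Term.var none : Language.ring.Term (Option α))).equal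
    (1 + Term.var (some j) * Term.var (some i) * Term.var (some i)),
    fun z => by simp [Formula.realize_equal]⟩

theorem sqCond_mul (i k j : α) : IsDef fun z => SqCond (z i * z k) (z j) := by
  refine ex ?_
  exact ⟨((Term.var none * Term.var none : Language.ring.Term (Option α))).equal
    (1 + Term.var (some j) * (Term.var (some i) * Term.var (some k)) *
      (Term.var (some i) * Term.var (some k))),
    fun z => by simp [Formula.realize_equal]⟩

theorem stab (i j : α) : IsDef fun z => Stab (z i) (z j) :=
  all ((sqCond none (some i)).imp (sqCond_mul none (some j) (some i)))

theorem lt (i j : α) : IsDef fun z => Lt (z i) (z j) :=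
  ex ((stab (some i) none).and (stab (some j) none).not)

theorem lim (n : ℕ) {α : Type} (i : α) : IsDef fun z => Lim n (z i) := by
  induction n generalizing α with
  | zero => exact ⟨⊤, fun _ => by simp [Lim]⟩
  | succ n ih =>
    refine all ((nonSq none).imp ((lt none (some i)).imp (ex ?_)))
    exact (nonSq none).and ((lt (some none) none).and ((lt none (some (some i))).and (ih none)))

theorem ring : IsDef fun z : Fin 1 → KK => z 0 ∈ KK.ring (Idx.threePow 1) := by
  simp only [mem_ring_iff]
  refine ex ((nonSq none).and ((lim 3 none).and (IsDef.and (ex ?_) (stab none (some 0)))))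
  exact (nonSq none).and (lt none (some none))

end IsDef

end KK

/-- there is a Henselian valued field `(K, A)` such that the valuation ring `A` is
definable in `K` by a parameter-free formula of the language of rings, but `A` is not definable
by any (parameter-free) `∃∀∃`-formula nor by any `∀∃∀`-formula of the language of rings. -/
theorem statement19 :
    ∃ (K : Type) (_ : Field K) (A : ValuationSubring K),
      HenselianLocalRing A ∧
      (∃ φ : Language.ring.Formula (Fin 1), ∀ x : K, x ∈ A ↔
        (letI := (FirstOrder.Ring.compatibleRingOfRing K).toStructure;
          Formula.Realize φ (fun _ => x))) ∧
      (¬ ∃ φ : Language.ring.Formula (Fin 1), IsQN true 3 φ ∧ ∀ x : K, x ∈ A ↔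
        (letI := (FirstOrder.Ring.compatibleRingOfRing K).toStructure;
          Formula.Realize φ (fun _ => x))) ∧
      (¬ ∃ φ : Language.ring.Formula (Fin 1), IsQN false 3 φ ∧ ∀ x : K, x ∈ A ↔
        (letI := (FirstOrder.Ring.compatibleRingOfRing K).toStructure;
          Formula.Realize φ (fun _ => x))) := by
  obtain ⟨i, hi⟩ := Idx.exists_gt (Idx.threePow 1)
  obtain ⟨φ, hφ⟩ := KK.IsDef.ring
  refine ⟨KK, inferInstance, KK.ring (Idx.threePow 1), KK.henselian_ring hi,
    ⟨φ, fun x => (hφ fun _ => x).symm⟩, ?_, ?_⟩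
  · rintro ⟨φ, hφ, H⟩
    exact KK.not_definable hφ H
  · rintro ⟨φ, hφ, H⟩
    exact KK.not_definable hφ H
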